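/- arXiv:2112.01861 — 2 statements merged into one kernel-verified Lean document; each statement's English description precedes it below -/
import Mathlib

section
/- Let ρ be a function of (t,x) that is four times differentiable in x and once in t, let ℓ = λρ, θ = e^{ℓ}, and u = θ v for a sufficiently smooth function v. Then θ(γ∂_t v + ∂_x⁴ v) = J₁ + J₂ + J₃ + J₄ pointwise, where J₁ = γ u_t − 4λρ_x u_{xxx} − 4λ³ρ_x³ u_x − 6λ³ρ_x²ρ_{xx} u, J₂ = u_{xxxx} + 6λ²ρ_x² u_{xx} + λ⁴ρ_x⁴ u + (3λ²ρ_{xx}² + 4λ²ρ_x ρ_{xxx}) u, J₃ = −6λρ_{xx} u_{xx} + (12λ²ρ_x ρ_{xx} − 4λρ_{xxx}) u_x, and J₄ = (−λρ_{xxxx} − γℓ_t) u. -/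
open Real

/-- The iterated derivatives of a `C^n` function are successive derivatives below order `n`. -/
theorem ContDiff.hasDerivAt_iteratedDeriv {f : ℝ → ℝ} {n : ℕ} (hf : ContDiff ℝ n f) {k : ℕ}
    (hk : k < n) (y : ℝ) :
    HasDerivAt (iteratedDeriv k f) (iteratedDeriv (k + 1) f y) y := by
  rw [iteratedDeriv_succ]
  exact (hf.differentiable_iteratedDeriv k (by exact_mod_cast hk) y).hasDerivAt

/-- The first four iterated derivatives of the conjugated function `exp (c * f) * g`. -/
theorem iteratedDeriv_exp_mul_mul {f g : ℝ → ℝ} (hf : ContDiff ℝ 4 f) (hg : ContDiff ℝ 4 g)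
    (c : ℝ) :
    let F : ℕ → ℝ → ℝ := fun k => iteratedDeriv k f
    let G : ℕ → ℝ → ℝ := fun k => iteratedDeriv k g
    let u : ℝ → ℝ := fun y => exp (c * f y) * g y
    (∀ y, iteratedDeriv 1 u y = exp (c * f y) * (G 1 y + c * F 1 y * G 0 y)) ∧
    (∀ y, iteratedDeriv 2 u y = exp (c * f y) *
      (G 2 y + 2 * c * F 1 y * G 1 y + (c * F 2 y + c ^ 2 * F 1 y ^ 2) * G 0 y)) ∧
    (∀ y, iteratedDeriv 3 u y = exp (c * f y) *
      (G 3 y + 3 * c * F 1 y * G 2 y + 3 * (c * F 2 y + c ^ 2 * F 1 y ^ 2) * G 1 y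
        + (c * F 3 y + 3 * c ^ 2 * F 1 y * F 2 y + c ^ 3 * F 1 y ^ 3) * G 0 y)) ∧
    (∀ y, iteratedDeriv 4 u y = exp (c * f y) *
      (G 4 y + 4 * c * F 1 y * G 3 y + 6 * (c * F 2 y + c ^ 2 * F 1 y ^ 2) * G 2 y
        + 4 * (c * F 3 y + 3 * c ^ 2 * F 1 y * F 2 y + c ^ 3 * F 1 y ^ 3) * G 1 y
        + (c * F 4 y + 4 * c ^ 2 * F 1 y * F 3 y + 3 * c ^ 2 * F 2 y ^ 2
          + 6 * c ^ 3 * F 1 y ^ 2 * F 2 y + c ^ 4 * F 1 y ^ 4) * G 0 y)) := by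
  intro F G u
  have hF : ∀ k < 4, ∀ y, HasDerivAt (F k) (F (k + 1) y) y := fun k hk y =>
    hf.hasDerivAt_iteratedDeriv (n := 4) hk y
  have hG : ∀ k < 4, ∀ y, HasDerivAt (G k) (G (k + 1) y) y := fun k hk y =>
    hg.hasDerivAt_iteratedDeriv (n := 4) hk y
  have hE : ∀ y, HasDerivAt (fun z => exp (c * f z)) (exp (c * f y) * (c * F 1 y)) y := by
    intro y
    have h := hF 0 (by norm_num) y
    simp only [F, iteratedDeriv_zero, zero_add] at h
    exact (h.const_mul c).exp
  have f1 := hF 1 (by norm_num)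
  have f2 := hF 2 (by norm_num)
  have f3 := hF 3 (by norm_num)
  have g0 := hG 0 (by norm_num)
  have g1 := hG 1 (by norm_num)
  have g2 := hG 2 (by norm_num)
  have g3 := hG 3 (by norm_num)
  have hu0 : iteratedDeriv 0 u = fun y => exp (c * f y) * G 0 y := by
    simp only [G, iteratedDeriv_zero, u]
  have key1 : ∀ y, iteratedDeriv 1 u y = exp (c * f y) * (G 1 y + c * F 1 y * G 0 y) := by
    intro y
    rw [iteratedDeriv_succ, hu0]
    refine (((hE y).fun_mul (g0 y)).congr_deriv ?_).deriv
    ring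
  have key2 : ∀ y, iteratedDeriv 2 u y = exp (c * f y) *
      (G 2 y + 2 * c * F 1 y * G 1 y + (c * F 2 y + c ^ 2 * F 1 y ^ 2) * G 0 y) := by
    intro y
    rw [iteratedDeriv_succ, funext key1]
    refine (((hE y).fun_mul ((g1 y).fun_add (((f1 y).const_mul c).fun_mul (g0 y)))).congr_deriv
      ?_).deriv
    ring
  have key3 : ∀ y, iteratedDeriv 3 u y = exp (c * f y) *
      (G 3 y + 3 * c * F 1 y * G 2 y + 3 * (c * F 2 y + c ^ 2 * F 1 y ^ 2) * G 1 y
        + (c * F 3 y + 3 * c ^ 2 * F 1 y * F 2 y + c ^ 3 * F 1 y ^ 3) * G 0 y) := by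
    intro y
    rw [iteratedDeriv_succ, funext key2]
    refine (((hE y).fun_mul (((g2 y).fun_add (((f1 y).const_mul (2 * c)).fun_mul (g1 y))).fun_add
      ((((f2 y).const_mul c).fun_add (((f1 y).fun_pow 2).const_mul (c ^ 2))).fun_mul
        (g0 y)))).congr_deriv ?_).deriv
    norm_num
    ring
  refine ⟨key1, key2, key3, fun y => ?_⟩
  rw [iteratedDeriv_succ, funext key3]
  have hA := ((f2 y).const_mul c).fun_add (((f1 y).fun_pow 2).const_mul (c ^ 2))
  have hB := (((f3 y).const_mul c).fun_add (((f1 y).const_mul (3 * c ^ 2)).fun_mul (f2 y))).fun_add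
    (((f1 y).fun_pow 3).const_mul (c ^ 3))
  refine (((hE y).fun_mul ((((g3 y).fun_add (((f1 y).const_mul (3 * c)).fun_mul (g2 y))).fun_add
    ((hA.const_mul 3).fun_mul (g1 y))).fun_add (hB.fun_mul (g0 y)))).congr_deriv ?_).deriv
  norm_num
  ring

/-- Pointwise decomposition `θ(γ∂_t v + ∂_x⁴ v) = J₁ + J₂ + J₃ + J₄` with
`ℓ = λρ`, `θ = e^{ℓ}`, `u = θ v`. -/
theorem pointwise_decomposition_J
    (γ lam : ℝ) (hlam : 0 < lam) (ρ v : ℝ → ℝ → ℝ)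
    (hρ : ContDiff ℝ 4 (Function.uncurry ρ)) (hv : ContDiff ℝ (⊤ : ℕ∞) (Function.uncurry v))
    (t x : ℝ) :
    let θ : ℝ → ℝ → ℝ := fun t' x' => exp (lam * ρ t' x');
    let u : ℝ → ℝ → ℝ := fun t' x' => θ t' x' * v t' x';
    let ρx := deriv (ρ t) x;
    let ρxx := iteratedDeriv 2 (ρ t) x;
    let ρxxx := iteratedDeriv 3 (ρ t) x;
    let ρxxxx := iteratedDeriv 4 (ρ t) x;
    θ t x * (γ * deriv (fun τ => v τ x) t + iteratedDeriv 4 (v t) x) =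
      (γ * deriv (fun τ => u τ x) t - 4 * lam * ρx * iteratedDeriv 3 (u t) x
          - 4 * lam ^ 3 * ρx ^ 3 * deriv (u t) x - 6 * lam ^ 3 * ρx ^ 2 * ρxx * u t x)
      + (iteratedDeriv 4 (u t) x + 6 * lam ^ 2 * ρx ^ 2 * iteratedDeriv 2 (u t) x
          + lam ^ 4 * ρx ^ 4 * u t x
          + (3 * lam ^ 2 * ρxx ^ 2 + 4 * lam ^ 2 * ρx * ρxxx) * u t x)
      + (-6 * lam * ρxx * iteratedDeriv 2 (u t) x
          + (12 * lam ^ 2 * ρx * ρxx - 4 * lam * ρxxx) * deriv (u t) x)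
      + (-lam * ρxxxx - γ * lam * deriv (fun τ => ρ τ x) t) * u t x := by
  intro θ u ρx ρxx ρxxx ρxxxx
  have hv4 : ContDiff ℝ 4 (Function.uncurry v) := contDiff_infty.1 hv 4
  have hρt : ContDiff ℝ 4 (ρ t) := hρ.comp (contDiff_prodMk_right t)
  have hvt : ContDiff ℝ 4 (v t) := hv4.comp (contDiff_prodMk_right t)
  have hρx : ContDiff ℝ 4 (fun τ => ρ τ x) := hρ.comp (contDiff_prodMk_left x)
  have hvx : ContDiff ℝ 4 (fun τ => v τ x) := hv4.comp (contDiff_prodMk_left x)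
  have dρ := (hρx.differentiable (by norm_num) t).hasDerivAt
  have dv := (hvx.differentiable (by norm_num) t).hasDerivAt
  have hut : deriv (fun τ => u τ x) t =
      exp (lam * ρ t x) * (lam * deriv (fun τ => ρ τ x) t) * v t x
        + exp (lam * ρ t x) * deriv (fun τ => v τ x) t :=
    ((dρ.const_mul lam).exp.fun_mul dv).deriv
  obtain ⟨h1, h2, h3, h4⟩ := iteratedDeriv_exp_mul_mul hρt hvt lam
  have e1 := h1 x
  have e2 := h2 x
  have e3 := h3 x
  have e4 := h4 x
  simp only [iteratedDeriv_one, iteratedDeriv_zero] at e1 e2 e3 e4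
  simp only [hut, u, θ, ρx, ρxx, ρxxx, ρxxxx, e1, e2, e3, e4]
  ring
end

section
/- There exists s₀ > 0 such that for every s ≥ s₀ there exist λ₀ = λ₀(s) > 0 and C > 0 with: for every v ∈ H⁴(Q) with γ∂_t v + ∂_x⁴ v ∈ L²(Q) and either v = v_x = 0 or v = v_{xx} = 0 on (0,T)×∂Ω, and every λ ≥ λ₀, ∫_Q θ² λ s² φ ( v_{xxx}² + λ²s²φ² v_{xx}² + λ⁴s⁴φ⁴ v_x² + λ⁶s⁶φ⁶ v² ) dx dt ≤ C ∫_0^T ∫_{ω₀} θ² λ s² φ ( v_{xxx}² + λ²s²φ² v_{xx}² + λ⁴s⁴φ⁴ v_x² + λ⁶s⁶φ⁶ v² ) dx dt + C ∫_Q θ² |γ∂_t v + ∂_x⁴ v|² dx dt. -/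
open MeasureTheory Real Set

/-- The weight `φ(t,x) = e^{sφ̂(x)}/(t(T-t))`. -/
noncomputable def wphi (s T : ℝ) (g : ℝ → ℝ) (t x : ℝ) : ℝ :=
  Real.exp (s * g x) / (t * (T - t))

/-- The weight `ρ(t,x) = (e^{sφ̂(x)} - e^{2s‖φ̂‖_C})/(t(T-t))`. -/
noncomputable def wrho (s T K : ℝ) (g : ℝ → ℝ) (t x : ℝ) : ℝ :=
  (Real.exp (s * g x) - Real.exp (2 * s * K)) / (t * (T - t))

/-- The symmetric part of the conjugated operator `e^ℓ ∂_x⁴ e^{-ℓ}`, where `a = ℓ_x`. -/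
def carlemanSym (a a1 w0 w1 w2 w4 : ℝ) : ℝ :=
  w4 + 6 * a ^ 2 * w2 + 12 * a * a1 * w1 + a ^ 4 * w0

/-- The essentially antisymmetric part of the conjugated operator. -/
def carlemanSkew (a a1 w0 w1 w3 : ℝ) : ℝ :=
  -4 * a * w3 - 4 * a ^ 3 * w1 - 6 * a ^ 2 * a1 * w0

/-- The boundary flux produced by multiplying the two parts and integrating by parts. -/
def carlemanFlux (γ a a1 w0 w1 w2 w3 p0 p1 : ℝ) : ℝ :=
  γ * (w3 * p0 - w2 * p1 + 6 * a ^ 2 * w1 * p0)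
    + (-2 * a * w3 ^ 2 - 4 * a ^ 3 * w1 * w3 - 10 * a ^ 3 * w2 ^ 2 - 30 * a ^ 2 * a1 * w1 * w2
      - 10 * a ^ 5 * w1 ^ 2 - 4 * a ^ 5 * w0 * w2 - 16 * a ^ 4 * a1 * w0 * w1
      - 2 * a ^ 7 * w0 ^ 2 - 6 * a ^ 2 * a1 * w0 * w3)

/-- The quadratic form obtained from the commutator of the two parts. -/
def carlemanForm (a a1 a2 w0 w1 w2 w3 : ℝ) : ℝ :=
  a1 * (2 * w3 ^ 2 + 60 * a ^ 2 * w2 ^ 2 + 18 * a ^ 4 * w1 ^ 2 + 8 * a ^ 6 * w0 ^ 2)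
    + (30 * (2 * a * a1 ^ 2 + a ^ 2 * a2) * (w1 * w2)
      + 6 * (2 * a * a1 ^ 2 + a ^ 2 * a2) * (w0 * w3)
      + (16 * a ^ 4 * a2 - 8 * a ^ 3 * a1 ^ 2) * (w0 * w1))

/-- The derivative of `carlemanFlux` along a solution. -/
def carlemanFluxDeriv (γ a a1 a2 w0 w1 w2 w3 w4 p0 p1 p2 : ℝ) : ℝ :=
  carlemanSym a a1 w0 w1 w2 w4 * (γ * p0 + carlemanSkew a a1 w0 w1 w3)
    - γ * (w2 * p2 - 6 * a ^ 2 * w1 * p1 + a ^ 4 * w0 * p0)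
    - carlemanForm a a1 a2 w0 w1 w2 w3

theorem hasDerivAt_carlemanFlux {a a1 w0 w1 w2 w3 p0 p1 : ℝ → ℝ} {γ x a2 w4 p2 : ℝ}
    (ha : HasDerivAt a (a1 x) x) (ha1 : HasDerivAt a1 a2 x)
    (h0 : HasDerivAt w0 (w1 x) x) (h1 : HasDerivAt w1 (w2 x) x)
    (h2 : HasDerivAt w2 (w3 x) x) (h3 : HasDerivAt w3 w4 x)
    (hp0 : HasDerivAt p0 (p1 x) x) (hp1 : HasDerivAt p1 p2 x) :
    HasDerivAt (fun y => carlemanFlux γ (a y) (a1 y) (w0 y) (w1 y) (w2 y) (w3 y) (p0 y) (p1 y))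
      (carlemanFluxDeriv γ (a x) (a1 x) a2 (w0 x) (w1 x) (w2 x) (w3 x) w4 (p0 x) (p1 x) p2) x := by
  unfold carlemanFlux
  have H := ((((h3.mul hp0).sub (h2.mul hp1)).add
      ((((ha.pow 2).const_mul 6).mul h1).mul hp0)).const_mul γ).add
    (((((((((((ha.const_mul (-2)).mul (h3.pow 2)).sub ((((ha.pow 3).const_mul 4).mul h1).mul h3)).sub
      (((ha.pow 3).const_mul 10).mul (h2.pow 2))).sub
      (((((ha.pow 2).const_mul 30).mul ha1).mul h1).mul h2)).sub
      (((ha.pow 5).const_mul 10).mul (h1.pow 2))).sub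
      ((((ha.pow 5).const_mul 4).mul h0).mul h2)).sub
      (((((ha.pow 4).const_mul 16).mul ha1).mul h0).mul h1)).sub
      (((ha.pow 7).const_mul 2).mul (h0.pow 2))).sub
      (((((ha.pow 2).const_mul 6).mul ha1).mul h0).mul h3)))
  refine H.congr_deriv ?_
  simp only [carlemanFluxDeriv, carlemanSym, carlemanSkew, carlemanForm, Pi.mul_apply,
    Pi.pow_apply]
  push_cast
  ring

theorem abs_mul_mul_le {c C x y : ℝ} (hc : |c| ≤ C) : |c * (x * y)| ≤ C * (x ^ 2 + y ^ 2) := by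
  have h1 : |x * y| ≤ x ^ 2 + y ^ 2 := by
    rw [abs_le]; constructor <;> nlinarith [sq_nonneg (x + y), sq_nonneg (x - y)]
  rw [abs_mul]
  exact mul_le_mul hc h1 (abs_nonneg _) ((abs_nonneg _).trans hc)

/-- The parameters of the weight at one point, bounded by `M`. -/
structure WeightBound (M γ κ ψ b b1 b2 b3 : ℝ) : Prop where
  one_le : 1 ≤ M
  hγ : |γ| ≤ M
  hκ : |κ| ≤ M
  hψ : |ψ| ≤ M
  hb : |b| ≤ M
  hb1 : |b1| ≤ M
  hb2 : |b2| ≤ M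
  hb3 : |b3| ≤ M

/-- The `τ`-weighted sum of squares, without the overall factor `τ`. -/
def weightedSq (τ w0 w1 w2 w3 : ℝ) : ℝ :=
  w3 ^ 2 + τ ^ 2 * w2 ^ 2 + τ ^ 4 * w1 ^ 2 + τ ^ 6 * w0 ^ 2

theorem weightedSq_nonneg (τ w0 w1 w2 w3 : ℝ) : 0 ≤ weightedSq τ w0 w1 w2 w3 := by
  unfold weightedSq; positivity

/-- The remainder of the conjugated operator, of lower order in `τ`. -/
def carlemanRem (γ ℓt a a1 a2 a3 w0 w1 w2 : ℝ) : ℝ :=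
  -γ * ℓt * w0 - 6 * a1 * w2 - 4 * a2 * w1 + (4 * a * a2 + 3 * a1 ^ 2 - a3) * w0

theorem carlemanRem_sq_le {M γ κ ψ b b1 b2 b3 τ : ℝ} (h : WeightBound M γ κ ψ b b1 b2 b3)
    (hτ : 1 ≤ τ) (w0 w1 w2 w3 : ℝ) :
    carlemanRem γ (κ * τ ^ 2 * ψ) (τ * b) (τ * b1) (τ * b2) (τ * b3) w0 w1 w2 ^ 2
      ≤ 1000 * M ^ 6 * weightedSq τ w0 w1 w2 w3 := by
  obtain ⟨hM, hγ, hκ, hψ, hb, hb1, hb2, hb3⟩ := h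
  have hM0 : 0 ≤ M := by linarith
  have hτ0 : 0 < τ := by linarith
  have e : carlemanRem γ (κ * τ ^ 2 * ψ) (τ * b) (τ * b1) (τ * b2) (τ * b3) w0 w1 w2
      = -(6 * b1) * (τ * w2) + -(4 * b2) * (τ * w1)
        + (-γ * κ * ψ + 4 * b * b2 + 3 * b1 ^ 2) * (τ ^ 2 * w0) + -b3 * (τ * w0) := by
    unfold carlemanRem; ring
  have k1 : |-(6 * b1)| ≤ 6 * M ^ 3 := by
    rw [abs_neg, abs_mul, abs_of_pos (by norm_num : (0:ℝ) < 6)]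
    have : M ≤ M ^ 3 := le_self_pow₀ hM (by norm_num)
    linarith
  have k2 : |-(4 * b2)| ≤ 4 * M ^ 3 := by
    rw [abs_neg, abs_mul, abs_of_pos (by norm_num : (0:ℝ) < 4)]
    have : M ≤ M ^ 3 := le_self_pow₀ hM (by norm_num)
    linarith
  have k3 : |-γ * κ * ψ + 4 * b * b2 + 3 * b1 ^ 2| ≤ 8 * M ^ 3 := by
    have h1 : |-γ * κ * ψ| ≤ M * M * M := by rw [abs_mul, abs_mul, abs_neg]; gcongr
    have h2 : |4 * b * b2| ≤ 4 * M * M := by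
      rw [abs_mul, abs_mul, abs_of_pos (by norm_num : (0:ℝ) < 4)]; gcongr
    have h3 : |3 * b1 ^ 2| ≤ 3 * M ^ 2 := by
      rw [abs_mul, abs_pow, abs_of_pos (by norm_num : (0:ℝ) < 3)]; gcongr
    have h4 := abs_add_three (-γ * κ * ψ) (4 * b * b2) (3 * b1 ^ 2)
    have : M ^ 2 ≤ M ^ 3 := pow_le_pow_right₀ hM (by norm_num)
    nlinarith
  have k4 : |-b3| ≤ M ^ 3 := by
    rw [abs_neg]; exact hb3.trans (le_self_pow₀ hM (by norm_num))
  have sqb : ∀ {c D y : ℝ}, |c| ≤ D → (c * y) ^ 2 ≤ D ^ 2 * y ^ 2 := by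
    intro c D y hc
    rw [mul_pow]
    exact mul_le_mul_of_nonneg_right (sq_le_sq' (by linarith [(abs_le.1 hc).1])
      (abs_le.1 hc).2) (sq_nonneg _)
  have s1 := sqb (y := τ * w2) k1
  have s2 := sqb (y := τ * w1) k2
  have s3 := sqb (y := τ ^ 2 * w0) k3
  have s4 := sqb (y := τ * w0) k4
  have t1 : τ ^ 2 ≤ τ ^ 4 := pow_le_pow_right₀ hτ (by norm_num)
  have t2 : τ ^ 4 ≤ τ ^ 6 := pow_le_pow_right₀ hτ (by norm_num)
  have u1 : τ ^ 2 * w1 ^ 2 ≤ τ ^ 4 * w1 ^ 2 := by gcongr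
  have u2 : τ ^ 4 * w0 ^ 2 ≤ τ ^ 6 * w0 ^ 2 := by gcongr
  have u3 : τ ^ 2 * w0 ^ 2 ≤ τ ^ 6 * w0 ^ 2 := by gcongr; norm_num
  have hM6 : (0:ℝ) ≤ M ^ 6 := by positivity
  rw [e]
  unfold weightedSq
  generalize -(6 * b1) * (τ * w2) = A1 at *
  generalize -(4 * b2) * (τ * w1) = A2 at *
  generalize (-γ * κ * ψ + 4 * b * b2 + 3 * b1 ^ 2) * (τ ^ 2 * w0) = A3 at *
  generalize -b3 * (τ * w0) = A4 at *
  have q : (A1 + A2 + A3 + A4) ^ 2 ≤ 4 * (A1 ^ 2 + A2 ^ 2 + A3 ^ 2 + A4 ^ 2) := by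
    nlinarith [sq_nonneg (A1 - A2), sq_nonneg (A1 - A3), sq_nonneg (A1 - A4),
      sq_nonneg (A2 - A3), sq_nonneg (A2 - A4), sq_nonneg (A3 - A4)]
  have v1 := mul_le_mul_of_nonneg_left u1 hM6
  have v2 := mul_le_mul_of_nonneg_left u2 hM6
  have v3 := mul_le_mul_of_nonneg_left u3 hM6
  have z1 : 0 ≤ M ^ 6 * (τ ^ 2 * w2 ^ 2) := by positivity
  have z2 : 0 ≤ M ^ 6 * (τ ^ 4 * w1 ^ 2) := by positivity
  have z3 : 0 ≤ M ^ 6 * (τ ^ 6 * w0 ^ 2) := by positivity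
  have z4 : 0 ≤ M ^ 6 * w3 ^ 2 := by positivity
  nlinarith

/-- The derivative in time of the coefficients of the energy. -/
def energyCoeffDeriv (γ a aₜ w0 w1 : ℝ) : ℝ :=
  γ * (-6 * a * aₜ * w1 ^ 2 + 2 * a ^ 3 * aₜ * w0 ^ 2)

theorem carleman_pointwise {M γ κ ψ b b1 b2 b3 τ : ℝ} (h : WeightBound M γ κ ψ b b1 b2 b3)
    (hτ : 1 ≤ τ) (w0 w1 w2 w3 w4 p0 p1 p2 F : ℝ)
    (hF : F = carlemanSym (τ * b) (τ * b1) w0 w1 w2 w4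
      + (γ * p0 + carlemanSkew (τ * b) (τ * b1) w0 w1 w3)
      + carlemanRem γ (κ * τ ^ 2 * ψ) (τ * b) (τ * b1) (τ * b2) (τ * b3) w0 w1 w2) :
    carlemanFluxDeriv γ (τ * b) (τ * b1) (τ * b2) w0 w1 w2 w3 w4 p0 p1 p2
      + (γ * (w2 * p2 - 6 * (τ * b) ^ 2 * w1 * p1 + (τ * b) ^ 4 * w0 * p0)
        + energyCoeffDeriv γ (τ * b) (κ * τ ^ 2 * b) w0 w1)
      ≤ F ^ 2 / 2
        - τ * b1 * (2 * w3 ^ 2 + 60 * b ^ 2 * (τ ^ 2 * w2 ^ 2) + 18 * b ^ 4 * (τ ^ 4 * w1 ^ 2)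
          + 8 * b ^ 6 * (τ ^ 6 * w0 ^ 2))
        + 1000 * M ^ 6 * weightedSq τ w0 w1 w2 w3 := by
  have hR := carlemanRem_sq_le h hτ w0 w1 w2 w3
  obtain ⟨hM, hγ, hκ, hψ, hb, hb1, hb2, hb3⟩ := h
  have hM0 : 0 ≤ M := by linarith
  have hτ0 : 0 < τ := by linarith
  set S := carlemanSym (τ * b) (τ * b1) w0 w1 w2 w4
  set A := γ * p0 + carlemanSkew (τ * b) (τ * b1) w0 w1 w3
  set R := carlemanRem γ (κ * τ ^ 2 * ψ) (τ * b) (τ * b1) (τ * b2) (τ * b3) w0 w1 w2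
  have hSA : S * A ≤ F ^ 2 / 2 + R ^ 2 / 2 := by
    rw [hF]; nlinarith [sq_nonneg (S - A), sq_nonneg (S + A + 2 * R)]
  have c1 : |2 * b * b1 ^ 2 + b ^ 2 * b2| ≤ 3 * M ^ 6 := by
    have h1 : |2 * b * b1 ^ 2| ≤ 2 * M * M ^ 2 := by
      rw [abs_mul, abs_mul, abs_pow, abs_of_pos (by norm_num : (0:ℝ) < 2)]; gcongr
    have h2 : |b ^ 2 * b2| ≤ M ^ 2 * M := by rw [abs_mul, abs_pow]; gcongr
    have h3 := abs_add_le (2 * b * b1 ^ 2) (b ^ 2 * b2)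
    have : M ^ 3 ≤ M ^ 6 := pow_le_pow_right₀ hM (by norm_num)
    nlinarith
  have c2 : |16 * b ^ 4 * b2 - 8 * b ^ 3 * b1 ^ 2| ≤ 24 * M ^ 6 := by
    have h1 : |16 * b ^ 4 * b2| ≤ 16 * M ^ 4 * M := by
      rw [abs_mul, abs_mul, abs_pow, abs_of_pos (by norm_num : (0:ℝ) < 16)]; gcongr
    have h2 : |8 * b ^ 3 * b1 ^ 2| ≤ 8 * M ^ 3 * M ^ 2 := by
      rw [abs_mul, abs_mul, abs_pow, abs_pow, abs_of_pos (by norm_num : (0:ℝ) < 8)]; gcongr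
    have h3 := abs_sub (16 * b ^ 4 * b2) (8 * b ^ 3 * b1 ^ 2)
    have : M ^ 5 ≤ M ^ 6 := pow_le_pow_right₀ hM (by norm_num)
    nlinarith
  have c3 : |γ * κ * b ^ 2| ≤ M ^ 6 := by
    have h1 : |γ * κ * b ^ 2| ≤ M * M * M ^ 2 := by rw [abs_mul, abs_mul, abs_pow]; gcongr
    have : M ^ 4 ≤ M ^ 6 := pow_le_pow_right₀ hM (by norm_num)
    nlinarith
  have c4 : |γ * κ * b ^ 4| ≤ M ^ 6 := by
    have h1 : |γ * κ * b ^ 4| ≤ M * M * M ^ 4 := by rw [abs_mul, abs_mul, abs_pow]; gcongr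
    nlinarith
  have d1 := abs_le.1 (abs_mul_mul_le (x := τ ^ 2 * w1) (y := τ * w2) c1)
  have d2 := abs_le.1 (abs_mul_mul_le (x := τ ^ 3 * w0) (y := w3) c1)
  have d3 := abs_le.1 (abs_mul_mul_le (x := τ ^ 3 * w0) (y := τ ^ 2 * w1) c2)
  have t3 : τ ^ 3 ≤ τ ^ 4 := pow_le_pow_right₀ hτ (by norm_num)
  have t5 : τ ^ 5 ≤ τ ^ 6 := pow_le_pow_right₀ hτ (by norm_num)
  have d4 : |(γ * κ * b ^ 2) * (τ ^ 3 * w1 ^ 2)| ≤ M ^ 6 * (τ ^ 4 * w1 ^ 2) := by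
    rw [abs_mul, abs_of_nonneg (by positivity : 0 ≤ τ ^ 3 * w1 ^ 2)]; gcongr
  have d5 : |(γ * κ * b ^ 4) * (τ ^ 5 * w0 ^ 2)| ≤ M ^ 6 * (τ ^ 6 * w0 ^ 2) := by
    rw [abs_mul, abs_of_nonneg (by positivity : 0 ≤ τ ^ 5 * w0 ^ 2)]; gcongr
  have d4' := abs_le.1 d4
  have d5' := abs_le.1 d5
  have e1 : carlemanFluxDeriv γ (τ * b) (τ * b1) (τ * b2) w0 w1 w2 w3 w4 p0 p1 p2
      + (γ * (w2 * p2 - 6 * (τ * b) ^ 2 * w1 * p1 + (τ * b) ^ 4 * w0 * p0)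
        + energyCoeffDeriv γ (τ * b) (κ * τ ^ 2 * b) w0 w1)
      = S * A - τ * b1 * (2 * w3 ^ 2 + 60 * b ^ 2 * (τ ^ 2 * w2 ^ 2)
          + 18 * b ^ 4 * (τ ^ 4 * w1 ^ 2) + 8 * b ^ 6 * (τ ^ 6 * w0 ^ 2))
        - 30 * ((2 * b * b1 ^ 2 + b ^ 2 * b2) * ((τ ^ 2 * w1) * (τ * w2)))
        - 6 * ((2 * b * b1 ^ 2 + b ^ 2 * b2) * ((τ ^ 3 * w0) * w3))
        - (16 * b ^ 4 * b2 - 8 * b ^ 3 * b1 ^ 2) * ((τ ^ 3 * w0) * (τ ^ 2 * w1))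
        - 6 * ((γ * κ * b ^ 2) * (τ ^ 3 * w1 ^ 2))
        + 2 * ((γ * κ * b ^ 4) * (τ ^ 5 * w0 ^ 2)) := by
    simp only [carlemanFluxDeriv, energyCoeffDeriv, carlemanForm, S, A]
    ring
  rw [e1]
  have z1 : 0 ≤ M ^ 6 * (τ ^ 2 * w2 ^ 2) := by positivity
  have z2 : 0 ≤ M ^ 6 * (τ ^ 4 * w1 ^ 2) := by positivity
  have z3 : 0 ≤ M ^ 6 * (τ ^ 6 * w0 ^ 2) := by positivity
  have z4 : 0 ≤ M ^ 6 * w3 ^ 2 := by positivity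
  unfold weightedSq at hR ⊢
  have x1 : (τ ^ 2 * w1) ^ 2 = τ ^ 4 * w1 ^ 2 := by ring
  have x2 : (τ * w2) ^ 2 = τ ^ 2 * w2 ^ 2 := by ring
  have x3 : (τ ^ 3 * w0) ^ 2 = τ ^ 6 * w0 ^ 2 := by ring
  rw [x1, x2] at d1
  rw [x3] at d2
  rw [x3, x1] at d3
  linarith [d1.1, d2.1, d3.1, d4'.1, d5'.2]

theorem carleman_pointwise_lower {M γ κ ψ b b1 b2 b3 τ δ : ℝ}
    (h : WeightBound M γ κ ψ b b1 b2 b3) (hδ : 0 < δ) (hδ1 : δ ≤ 1)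
    (hτ : 1 + 1000 * M ^ 6 / δ ^ 4 ≤ τ) (w0 w1 w2 w3 : ℝ) (hb1 : δ ≤ b1) (hb : δ ≤ b ^ 2) :
    - τ * b1 * (2 * w3 ^ 2 + 60 * b ^ 2 * (τ ^ 2 * w2 ^ 2) + 18 * b ^ 4 * (τ ^ 4 * w1 ^ 2)
          + 8 * b ^ 6 * (τ ^ 6 * w0 ^ 2)) + 1000 * M ^ 6 * weightedSq τ w0 w1 w2 w3
      ≤ -δ ^ 4 * (τ * weightedSq τ w0 w1 w2 w3) := by
  have hM := h.one_le
  have hτ0 : 0 < τ := lt_of_lt_of_le (by positivity) hτ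
  have hN := weightedSq_nonneg τ w0 w1 w2 w3
  have k : 1000 * M ^ 6 ≤ δ ^ 4 * τ := by
    have : 1000 * M ^ 6 / δ ^ 4 ≤ τ := by linarith
    rw [div_le_iff₀ (by positivity)] at this
    linarith
  have d3 : δ ^ 3 ≤ 1 := pow_le_one₀ hδ.le hδ1
  have d3' : δ ^ 3 ≤ δ := pow_le_of_le_one hδ.le hδ1 (by norm_num)
  have d3'' : δ ^ 3 ≤ δ ^ 2 := pow_le_pow_of_le_one hδ.le hδ1 (by norm_num)
  have e4 : δ ^ 2 ≤ b ^ 4 := by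
    calc δ ^ 2 ≤ (b ^ 2) ^ 2 := by gcongr
      _ = b ^ 4 := by ring
  have e6 : δ ^ 3 ≤ b ^ 6 := by
    calc δ ^ 3 ≤ (b ^ 2) ^ 3 := by gcongr
      _ = b ^ 6 := by ring
  have A : 2 * δ ^ 3 * weightedSq τ w0 w1 w2 w3 ≤ 2 * w3 ^ 2 + 60 * b ^ 2 * (τ ^ 2 * w2 ^ 2)
      + 18 * b ^ 4 * (τ ^ 4 * w1 ^ 2) + 8 * b ^ 6 * (τ ^ 6 * w0 ^ 2) := by
    have a1 : 2 * δ ^ 3 * w3 ^ 2 ≤ 2 * w3 ^ 2 := by gcongr; linarith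
    have a2 : 2 * δ ^ 3 * (τ ^ 2 * w2 ^ 2) ≤ 60 * b ^ 2 * (τ ^ 2 * w2 ^ 2) := by
      gcongr ?_ * _; linarith
    have a3 : 2 * δ ^ 3 * (τ ^ 4 * w1 ^ 2) ≤ 18 * b ^ 4 * (τ ^ 4 * w1 ^ 2) := by
      gcongr ?_ * _; linarith [pow_pos hδ 3]
    have a4 : 2 * δ ^ 3 * (τ ^ 6 * w0 ^ 2) ≤ 8 * b ^ 6 * (τ ^ 6 * w0 ^ 2) := by
      gcongr ?_ * _; linarith [pow_pos hδ 3]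
    unfold weightedSq; linarith
  have B := mul_le_mul_of_nonneg_left A (by positivity : 0 ≤ τ * δ)
  have B' : τ * δ * (2 * w3 ^ 2 + 60 * b ^ 2 * (τ ^ 2 * w2 ^ 2)
      + 18 * b ^ 4 * (τ ^ 4 * w1 ^ 2) + 8 * b ^ 6 * (τ ^ 6 * w0 ^ 2)) ≤
      τ * b1 * (2 * w3 ^ 2 + 60 * b ^ 2 * (τ ^ 2 * w2 ^ 2)
      + 18 * b ^ 4 * (τ ^ 4 * w1 ^ 2) + 8 * b ^ 6 * (τ ^ 6 * w0 ^ 2)) := by gcongr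
  have K := mul_le_mul_of_nonneg_right k hN
  linarith

theorem carleman_pointwise_upper {M γ κ ψ b b1 b2 b3 τ : ℝ}
    (h : WeightBound M γ κ ψ b b1 b2 b3) (hτ : 1 ≤ τ) (w0 w1 w2 w3 : ℝ) :
    - τ * b1 * (2 * w3 ^ 2 + 60 * b ^ 2 * (τ ^ 2 * w2 ^ 2) + 18 * b ^ 4 * (τ ^ 4 * w1 ^ 2)
          + 8 * b ^ 6 * (τ ^ 6 * w0 ^ 2)) + 1000 * M ^ 6 * weightedSq τ w0 w1 w2 w3
      ≤ 1060 * M ^ 7 * (τ * weightedSq τ w0 w1 w2 w3) := by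
  have hM := h.one_le
  have hN := weightedSq_nonneg τ w0 w1 w2 w3
  have m1 : 1 ≤ M ^ 6 := one_le_pow₀ hM
  have f2 : b ^ 2 ≤ M ^ 2 := sq_le_sq' (by linarith [(abs_le.1 h.hb).1]) (abs_le.1 h.hb).2
  have e2 : b ^ 2 ≤ M ^ 6 := f2.trans (pow_le_pow_right₀ hM (by norm_num))
  have e4 : b ^ 4 ≤ M ^ 6 := by
    calc b ^ 4 = (b ^ 2) ^ 2 := by ring
      _ ≤ (M ^ 2) ^ 2 := by gcongr
      _ = M ^ 4 := by ring
      _ ≤ _ := pow_le_pow_right₀ hM (by norm_num)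
  have e6 : b ^ 6 ≤ M ^ 6 := by
    calc b ^ 6 = (b ^ 2) ^ 3 := by ring
      _ ≤ (M ^ 2) ^ 3 := by gcongr
      _ = M ^ 6 := by ring
  have A : 2 * w3 ^ 2 + 60 * b ^ 2 * (τ ^ 2 * w2 ^ 2)
      + 18 * b ^ 4 * (τ ^ 4 * w1 ^ 2) + 8 * b ^ 6 * (τ ^ 6 * w0 ^ 2)
      ≤ 60 * M ^ 6 * weightedSq τ w0 w1 w2 w3 := by
    have a1 : 2 * w3 ^ 2 ≤ 60 * M ^ 6 * w3 ^ 2 := by gcongr; linarith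
    have a2 : 60 * b ^ 2 * (τ ^ 2 * w2 ^ 2) ≤ 60 * M ^ 6 * (τ ^ 2 * w2 ^ 2) := by
      gcongr ?_ * _; linarith
    have a3 : 18 * b ^ 4 * (τ ^ 4 * w1 ^ 2) ≤ 60 * M ^ 6 * (τ ^ 4 * w1 ^ 2) := by
      gcongr ?_ * _; linarith
    have a4 : 8 * b ^ 6 * (τ ^ 6 * w0 ^ 2) ≤ 60 * M ^ 6 * (τ ^ 6 * w0 ^ 2) := by
      gcongr ?_ * _; linarith
    unfold weightedSq; linarith
  have hb1 : -b1 ≤ M := by linarith [(abs_le.1 h.hb1).1]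
  have B := mul_le_mul hb1 A (by positivity) (by linarith)
  have B' := mul_le_mul_of_nonneg_left B (by linarith : 0 ≤ τ)
  have m7 : M ^ 6 ≤ M ^ 7 := pow_le_pow_right₀ hM (by norm_num)
  have C1 : 1000 * M ^ 6 * weightedSq τ w0 w1 w2 w3
      ≤ 1000 * M ^ 7 * (τ * weightedSq τ w0 w1 w2 w3) := by
    gcongr
    exact le_mul_of_one_le_left hN hτ
  linarith

theorem sq_comb_le {D c1 c2 c3 x0 x1 x2 x3 : ℝ} (hD : 1 ≤ D) (h1 : |c1| ≤ D) (h2 : |c2| ≤ D)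
    (h3 : |c3| ≤ D) :
    (x0 + c1 * x1 + c2 * x2 + c3 * x3) ^ 2
      ≤ 4 * D ^ 2 * (x0 ^ 2 + x1 ^ 2 + x2 ^ 2 + x3 ^ 2) := by
  have sqb : ∀ {c y : ℝ}, |c| ≤ D → (c * y) ^ 2 ≤ D ^ 2 * y ^ 2 := by
    intro c y hc
    rw [mul_pow]
    exact mul_le_mul_of_nonneg_right (sq_le_sq' (by linarith [(abs_le.1 hc).1])
      (abs_le.1 hc).2) (sq_nonneg _)
  have s1 := sqb (y := x1) h1
  have s2 := sqb (y := x2) h2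
  have s3 := sqb (y := x3) h3
  have s0 : x0 ^ 2 ≤ D ^ 2 * x0 ^ 2 :=
    le_mul_of_one_le_left (sq_nonneg _) (one_le_pow₀ hD)
  generalize c1 * x1 = A1 at *
  generalize c2 * x2 = A2 at *
  generalize c3 * x3 = A3 at *
  nlinarith [sq_nonneg (x0 - A1), sq_nonneg (x0 - A2), sq_nonneg (x0 - A3),
    sq_nonneg (A1 - A2), sq_nonneg (A1 - A3), sq_nonneg (A2 - A3)]

theorem weightedSq_conj_le {M b b1 b2 τ : ℝ} (hM : 1 ≤ M) (hb : |b| ≤ M) (hb1 : |b1| ≤ M)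
    (hb2 : |b2| ≤ M) (hτ : 1 ≤ τ) (u0 u1 u2 u3 : ℝ) :
    weightedSq τ u0 (u1 + τ * b * u0)
        (u2 + 2 * (τ * b) * u1 + ((τ * b) ^ 2 + τ * b1) * u0)
        (u3 + 3 * (τ * b) * u2 + 3 * ((τ * b) ^ 2 + τ * b1) * u1
          + ((τ * b) ^ 3 + 3 * (τ * b) * (τ * b1) + τ * b2) * u0)
      ≤ 1600 * M ^ 6 * weightedSq τ u0 u1 u2 u3 := by
  have hτ0 : 0 < τ := by linarith
  have hM0 : 0 ≤ M := by linarith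
  obtain ⟨r, hr0, hr1, hr⟩ : ∃ r : ℝ, 0 ≤ r ∧ r ≤ 1 ∧ τ * r = 1 :=
    ⟨τ⁻¹, by positivity, inv_le_one_of_one_le₀ hτ, mul_inv_cancel₀ hτ0.ne'⟩
  have hra : |r| ≤ 1 := by rw [abs_of_nonneg hr0]; exact hr1
  have m1 : M ≤ M ^ 3 := le_self_pow₀ hM (by norm_num)
  have m2 : M ^ 2 ≤ M ^ 3 := pow_le_pow_right₀ hM (by norm_num)
  have m0 : 1 ≤ M ^ 3 := one_le_pow₀ hM
  have hD : 1 ≤ 10 * M ^ 3 := by linarith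
  have k0 : |(0:ℝ)| ≤ 10 * M ^ 3 := by simp; positivity
  have n2 : |(2:ℝ)| = 2 := abs_of_pos (by norm_num)
  have n3 : |(3:ℝ)| = 3 := abs_of_pos (by norm_num)
  have k1 : |b| ≤ 10 * M ^ 3 := by linarith
  have k2 : |2 * b| ≤ 10 * M ^ 3 := by rw [abs_mul, n2]; linarith
  have k3 : |3 * b| ≤ 10 * M ^ 3 := by rw [abs_mul, n3]; linarith
  have k4' : |b ^ 2 + r * b1| ≤ 2 * M ^ 3 := by
    have h1 : |b ^ 2| ≤ M ^ 2 := by rw [abs_pow]; gcongr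
    have h2 : |r * b1| ≤ 1 * M := by rw [abs_mul]; gcongr
    linarith [abs_add_le (b ^ 2) (r * b1)]
  have k4 : |b ^ 2 + r * b1| ≤ 10 * M ^ 3 := by linarith
  have k5 : |3 * (b ^ 2 + r * b1)| ≤ 10 * M ^ 3 := by rw [abs_mul, n3]; linarith
  have k6 : |b ^ 3 + 3 * b * (r * b1) + r ^ 2 * b2| ≤ 10 * M ^ 3 := by
    have h1 : |b ^ 3| ≤ M ^ 3 := by rw [abs_pow]; gcongr
    have h2 : |3 * b * (r * b1)| ≤ 3 * M * (1 * M) := by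
      rw [abs_mul, abs_mul, abs_mul, n3]; gcongr
    have h3 : |r ^ 2 * b2| ≤ 1 ^ 2 * M := by rw [abs_mul, abs_pow]; gcongr
    linarith [abs_add_three (b ^ 3) (3 * b * (r * b1)) (r ^ 2 * b2)]
  have s3 := sq_comb_le (x0 := u3) (x1 := τ * u2) (x2 := τ ^ 2 * u1) (x3 := τ ^ 3 * u0) hD k3 k5 k6
  have s2 := sq_comb_le (x0 := τ * u2) (x1 := τ ^ 2 * u1) (x2 := τ ^ 3 * u0) (x3 := u3) hD k2 k4 k0
  have s1 := sq_comb_le (x0 := τ ^ 2 * u1) (x1 := τ ^ 3 * u0) (x2 := u3) (x3 := τ * u2) hD k1 k0 k0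
  have s0 := sq_comb_le (x0 := τ ^ 3 * u0) (x1 := u3) (x2 := τ * u2) (x3 := τ ^ 2 * u1) hD k0 k0 k0
  have hr2 : τ ^ 2 * r = τ := by linear_combination τ * hr
  have e3 : u3 + 3 * (τ * b) * u2 + 3 * ((τ * b) ^ 2 + τ * b1) * u1
          + ((τ * b) ^ 3 + 3 * (τ * b) * (τ * b1) + τ * b2) * u0
      = u3 + 3 * b * (τ * u2) + 3 * (b ^ 2 + r * b1) * (τ ^ 2 * u1)
        + (b ^ 3 + 3 * b * (r * b1) + r ^ 2 * b2) * (τ ^ 3 * u0) := by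
    linear_combination (-3 * b1 * τ * u1 - 3 * b * b1 * τ ^ 2 * u0
      - b2 * u0 * τ * (τ * r + 1)) * hr
  have e2 : τ * (u2 + 2 * (τ * b) * u1 + ((τ * b) ^ 2 + τ * b1) * u0)
      = τ * u2 + 2 * b * (τ ^ 2 * u1) + (b ^ 2 + r * b1) * (τ ^ 3 * u0) + 0 * u3 := by
    linear_combination (- b1 * τ ^ 2 * u0) * hr
  have e1 : τ ^ 2 * (u1 + τ * b * u0)
      = τ ^ 2 * u1 + b * (τ ^ 3 * u0) + 0 * u3 + 0 * (τ * u2) := by ring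
  have e0 : τ ^ 3 * u0 = τ ^ 3 * u0 + 0 * u3 + 0 * (τ * u2) + 0 * (τ ^ 2 * u1) := by ring
  rw [← e3] at s3
  rw [← e2] at s2
  rw [← e1] at s1
  rw [← e0] at s0
  generalize u3 + 3 * (τ * b) * u2 + 3 * ((τ * b) ^ 2 + τ * b1) * u1
          + ((τ * b) ^ 3 + 3 * (τ * b) * (τ * b1) + τ * b2) * u0 = X3 at *
  generalize u2 + 2 * (τ * b) * u1 + ((τ * b) ^ 2 + τ * b1) * u0 = X2 at *
  generalize u1 + τ * b * u0 = X1 at *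
  have x1 : ∀ y, (τ ^ 2 * y) ^ 2 = τ ^ 4 * y ^ 2 := fun y => by ring
  have x0 : ∀ y, (τ ^ 3 * y) ^ 2 = τ ^ 6 * y ^ 2 := fun y => by ring
  have hDD : 4 * (10 * M ^ 3) ^ 2 = 400 * M ^ 6 := by ring
  simp only [x1, x0, mul_pow τ, hDD] at s0 s1 s2 s3
  unfold weightedSq
  linarith

theorem weightedSq_le_conj {M b b1 b2 τ : ℝ} (hM : 1 ≤ M) (hb : |b| ≤ M) (hb1 : |b1| ≤ M)
    (hb2 : |b2| ≤ M) (hτ : 1 ≤ τ) (u0 u1 u2 u3 : ℝ) :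
    weightedSq τ u0 u1 u2 u3 ≤ 1600 * M ^ 6 *
      weightedSq τ u0 (u1 + τ * b * u0)
        (u2 + 2 * (τ * b) * u1 + ((τ * b) ^ 2 + τ * b1) * u0)
        (u3 + 3 * (τ * b) * u2 + 3 * ((τ * b) ^ 2 + τ * b1) * u1
          + ((τ * b) ^ 3 + 3 * (τ * b) * (τ * b1) + τ * b2) * u0) := by
  have := weightedSq_conj_le (b := -b) (b1 := -b1) (b2 := -b2) hM (by rwa [abs_neg])
    (by rwa [abs_neg]) (by rwa [abs_neg]) hτ u0 (u1 + τ * b * u0)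
        (u2 + 2 * (τ * b) * u1 + ((τ * b) ^ 2 + τ * b1) * u0)
        (u3 + 3 * (τ * b) * u2 + 3 * ((τ * b) ^ 2 + τ * b1) * u1
          + ((τ * b) ^ 3 + 3 * (τ * b) * (τ * b1) + τ * b2) * u0)
  refine le_trans (le_of_eq ?_) this
  congr 1 <;> ring

theorem carlemanFlux_boundary {M γ κ ψ b b1 b2 b3 τ δ σ : ℝ}
    (h : WeightBound M γ κ ψ b b1 b2 b3) (hδ : 0 < δ) (hσ : σ = 1 ∨ σ = -1) (hb : δ ≤ σ * b)
    (hτ : 1 + 61 * M ^ 4 / (48 * δ ^ 5) ≤ τ) {w0 w1 w2 w3 p0 p1 : ℝ} (h0 : w0 = 0) (hp0 : p0 = 0)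
    (hbd : (w1 = 0 ∧ p1 = 0) ∨ w2 = 2 * (τ * b) * w1) :
    σ * (carlemanFlux γ (τ * b) (τ * b1) w0 w1 w2 w3 p0 p1
      + γ * (κ * τ ^ 2 * b * w1 ^ 2 + τ * b * (2 * w1 * p1))) ≤ 0 := by
  have hM := h.one_le
  have hτ1 : 1 ≤ τ := le_trans (by have : 0 ≤ 61 * M ^ 4 / (48 * δ ^ 5) := by positivity
                                   linarith) hτ
  have hτ0 : 0 < τ := by linarith
  have hs2 : σ ^ 2 = 1 := by rcases hσ with rfl | rfl <;> norm_num
  obtain ⟨c, hc⟩ : ∃ c, c = σ * b := ⟨_, rfl⟩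
  have hbc : b = σ * c := by rw [hc]; linear_combination (-b) * hs2
  rw [← hc] at hb
  have hc0 : 0 < c := by linarith
  subst h0 hp0
  rcases hbd with ⟨rfl, rfl⟩ | rfl
  · have : σ * (carlemanFlux γ (τ * b) (τ * b1) 0 0 w2 w3 0 0
      + γ * (κ * τ ^ 2 * b * 0 ^ 2 + τ * b * (2 * 0 * 0)))
      = -(σ ^ 2) * (τ * c) * (2 * w3 ^ 2 + σ ^ 2 * (10 * τ ^ 2 * c ^ 2 * w2 ^ 2)) := by
      unfold carlemanFlux; rw [hbc]; ring
    rw [this, hs2]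
    have : 0 ≤ (τ * c) * (2 * w3 ^ 2 + 1 * (10 * τ ^ 2 * c ^ 2 * w2 ^ 2)) := by positivity
    linarith
  · have e : σ * (carlemanFlux γ (τ * b) (τ * b1) 0 w1 (2 * (τ * b) * w1) w3 0 p1
      + γ * (κ * τ ^ 2 * b * w1 ^ 2 + τ * b * (2 * w1 * p1)))
      = -(2 * τ * (σ * b) * w3 ^ 2 + 4 * τ ^ 3 * (σ * b) * b ^ 2 * (w1 * w3)
          + 50 * τ ^ 5 * (σ * b) * b ^ 4 * w1 ^ 2)
        + (-60 * σ * b ^ 3 * b1 * τ ^ 4 + σ * γ * κ * b * τ ^ 2) * w1 ^ 2 := by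
      unfold carlemanFlux; ring
    have hb2 : b ^ 2 = c ^ 2 := by rw [hbc, mul_pow, hs2, one_mul]
    have hb4 : b ^ 4 = c ^ 4 := by
      calc b ^ 4 = (b ^ 2) ^ 2 := by ring
        _ = _ := by rw [hb2]; ring
    have e' : 2 * τ * c * w3 ^ 2 + 4 * τ ^ 3 * c * c ^ 2 * (w1 * w3)
          + 50 * τ ^ 5 * c * c ^ 4 * w1 ^ 2
        = 2 * τ * c * (w3 + τ ^ 2 * c ^ 2 * w1) ^ 2 + 48 * τ ^ 5 * c ^ 5 * w1 ^ 2 := by ring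
    rw [e, ← hc, hb2, hb4, e']
    have hσa : |σ| = 1 := by rcases hσ with rfl | rfl <;> simp
    have hM0 : 0 ≤ M := by linarith
    have k1 : |60 * σ * b ^ 3 * b1| ≤ 60 * M ^ 4 := by
      rw [abs_mul, abs_mul, abs_mul, abs_pow, hσa, abs_of_pos (by norm_num : (0:ℝ) < 60)]
      calc 60 * 1 * |b| ^ 3 * |b1| ≤ 60 * 1 * M ^ 3 * M := by
            have := h.hb; have := h.hb1; gcongr
        _ = _ := by ring
    have k2 : |σ * γ * κ * b| ≤ M ^ 4 := by
      rw [abs_mul, abs_mul, abs_mul, hσa]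
      calc 1 * |γ| * |κ| * |b| ≤ 1 * M * M * M := by
            have := h.hb; have := h.hγ; have := h.hκ; gcongr
        _ = M ^ 3 := by ring
        _ ≤ M ^ 4 := pow_le_pow_right₀ hM (by norm_num)
    have t24 : τ ^ 2 ≤ τ ^ 4 := pow_le_pow_right₀ hτ1 (by norm_num)
    have k3 : -60 * σ * b ^ 3 * b1 * τ ^ 4 + σ * γ * κ * b * τ ^ 2 ≤ 61 * M ^ 4 * τ ^ 4 := by
      have a1 : -60 * σ * b ^ 3 * b1 * τ ^ 4 ≤ 60 * M ^ 4 * τ ^ 4 := by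
        gcongr ?_ * _; linarith [(abs_le.1 k1).1]
      have a2 : σ * γ * κ * b * τ ^ 2 ≤ M ^ 4 * τ ^ 4 :=
        calc σ * γ * κ * b * τ ^ 2 ≤ M ^ 4 * τ ^ 2 := by
              gcongr ?_ * _; linarith [(abs_le.1 k2).2]
          _ ≤ _ := by gcongr
      linarith
    have k4 : 61 * M ^ 4 ≤ 48 * δ ^ 5 * τ := by
      have : 61 * M ^ 4 / (48 * δ ^ 5) ≤ τ := by linarith
      rw [div_le_iff₀ (by positivity)] at this
      linarith
    have k5 : δ ^ 5 ≤ c ^ 5 := by gcongr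
    have k6 : 61 * M ^ 4 * τ ^ 4 ≤ 48 * τ ^ 5 * c ^ 5 :=
      calc 61 * M ^ 4 * τ ^ 4 ≤ 48 * δ ^ 5 * τ * τ ^ 4 := by gcongr
        _ = 48 * τ ^ 5 * δ ^ 5 := by ring
        _ ≤ _ := by gcongr
    have k7 := mul_le_mul_of_nonneg_right (k3.trans k6) (sq_nonneg w1)
    have k8 : 0 ≤ 2 * τ * c * (w3 + τ ^ 2 * c ^ 2 * w1) ^ 2 := by positivity
    linarith

/-- `v1, …, v4` are the space derivatives of `v0`, and `q0, q1, q2` the time derivatives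
of `v0, v1, v2`; all are jointly continuous. -/
structure SpaceTimeJet (v0 v1 v2 v3 v4 q0 q1 q2 : ℝ → ℝ → ℝ) : Prop where
  c0 : Continuous (Function.uncurry v0)
  c1 : Continuous (Function.uncurry v1)
  c2 : Continuous (Function.uncurry v2)
  c3 : Continuous (Function.uncurry v3)
  c4 : Continuous (Function.uncurry v4)
  cq0 : Continuous (Function.uncurry q0)
  cq1 : Continuous (Function.uncurry q1)
  cq2 : Continuous (Function.uncurry q2)
  d0 : ∀ t x, HasDerivAt (v0 t) (v1 t x) x
  d1 : ∀ t x, HasDerivAt (v1 t) (v2 t x) x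
  d2 : ∀ t x, HasDerivAt (v2 t) (v3 t x) x
  d3 : ∀ t x, HasDerivAt (v3 t) (v4 t x) x
  dq0 : ∀ t x, HasDerivAt (q0 t) (q1 t x) x
  dq1 : ∀ t x, HasDerivAt (q1 t) (q2 t x) x
  e0 : ∀ t x, HasDerivAt (fun r => v0 r x) (q0 t x) t
  e1 : ∀ t x, HasDerivAt (fun r => v1 r x) (q1 t x) t
  e2 : ∀ t x, HasDerivAt (fun r => v2 r x) (q2 t x) t

theorem hasDerivAt_slice_space {f : ℝ × ℝ → ℝ} (hf : Differentiable ℝ f) (t x : ℝ) :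
    HasDerivAt (fun y => f (t, y)) (fderiv ℝ f (t, x) (0, 1)) x :=
  (hf (t, x)).hasFDerivAt.comp_hasDerivAt x ((hasDerivAt_const x t).prodMk (hasDerivAt_id x))

theorem hasDerivAt_slice_time {f : ℝ × ℝ → ℝ} (hf : Differentiable ℝ f) (t x : ℝ) :
    HasDerivAt (fun r => f (r, x)) (fderiv ℝ f (t, x) (1, 0)) t :=
  (hf (t, x)).hasFDerivAt.comp_hasDerivAt t ((hasDerivAt_id t).prodMk (hasDerivAt_const t x))

theorem fderiv_apply_comm {f : ℝ × ℝ → ℝ} (hf : ContDiff ℝ 2 f) (u w z : ℝ × ℝ) :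
    fderiv ℝ (fun y => fderiv ℝ f y u) z w = fderiv ℝ (fun y => fderiv ℝ f y w) z u := by
  have hd : DifferentiableAt ℝ (fderiv ℝ f) z :=
    (hf.fderiv_right (m := 1) (by norm_num)).differentiable (by norm_num) z
  have key : ∀ u w : ℝ × ℝ,
      fderiv ℝ (fun y => fderiv ℝ f y u) z w = fderiv ℝ (fderiv ℝ f) z w u := by
    intro u w
    rw [fderiv_clm_apply hd (differentiableAt_const u)]
    simp
  rw [key, key]
  exact second_derivative_symmetric
    (fun y => (hf.differentiable (by norm_num) y).hasFDerivAt) hd.hasFDerivAt w u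

theorem contDiff_fderiv_apply {f : ℝ × ℝ → ℝ} {m n : ℕ} (hf : ContDiff ℝ n f) (hmn : m + 1 ≤ n)
    (u : ℝ × ℝ) : ContDiff ℝ m (fun y => fderiv ℝ f y u) :=
  (hf.fderiv_right (by exact_mod_cast hmn)).clm_apply contDiff_const

theorem exists_spaceTimeJet {v : ℝ → ℝ → ℝ} (hv : ContDiff ℝ 4 (Function.uncurry v)) :
    ∃ v1 v2 v3 v4 q0 q1 q2, SpaceTimeJet v v1 v2 v3 v4 q0 q1 q2 := by
  set f0 : ℝ × ℝ → ℝ := Function.uncurry v with hf0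
  set f1 : ℝ × ℝ → ℝ := fun z => fderiv ℝ f0 z (0, 1) with hf1
  set f2 : ℝ × ℝ → ℝ := fun z => fderiv ℝ f1 z (0, 1) with hf2
  set f3 : ℝ × ℝ → ℝ := fun z => fderiv ℝ f2 z (0, 1) with hf3
  set f4 : ℝ × ℝ → ℝ := fun z => fderiv ℝ f3 z (0, 1) with hf4
  set g0 : ℝ × ℝ → ℝ := fun z => fderiv ℝ f0 z (1, 0) with hg0
  set g1 : ℝ × ℝ → ℝ := fun z => fderiv ℝ f1 z (1, 0) with hg1
  set g2 : ℝ × ℝ → ℝ := fun z => fderiv ℝ f2 z (1, 0) with hg2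
  have h0 : ContDiff ℝ ((4 : ℕ)) f0 := by exact_mod_cast hv
  have h1 : ContDiff ℝ ((3 : ℕ)) f1 := contDiff_fderiv_apply h0 (by norm_num) _
  have h2 : ContDiff ℝ ((2 : ℕ)) f2 := contDiff_fderiv_apply h1 (by norm_num) _
  have h3 : ContDiff ℝ ((1 : ℕ)) f3 := contDiff_fderiv_apply h2 (by norm_num) _
  have h4 : ContDiff ℝ ((0 : ℕ)) f4 := contDiff_fderiv_apply h3 (by norm_num) _
  have k0 : ContDiff ℝ ((3 : ℕ)) g0 := contDiff_fderiv_apply h0 (by norm_num) _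
  have k1 : ContDiff ℝ ((2 : ℕ)) g1 := contDiff_fderiv_apply h1 (by norm_num) _
  have k2 : ContDiff ℝ ((1 : ℕ)) g2 := contDiff_fderiv_apply h2 (by norm_num) _
  have D : ∀ {n : ℕ} {f : ℝ × ℝ → ℝ}, ContDiff ℝ n f → 1 ≤ n → Differentiable ℝ f :=
    fun h hn => h.differentiable (by exact_mod_cast (Nat.one_le_iff_ne_zero.1 hn))
  have s1 : ∀ z, fderiv ℝ g0 z (0, 1) = g1 z := fun z =>
    fderiv_apply_comm (h0.of_le (by norm_num)) _ _ _
  have s2 : ∀ z, fderiv ℝ g1 z (0, 1) = g2 z := fun z =>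
    fderiv_apply_comm (h1.of_le (by norm_num)) _ _ _
  refine ⟨fun t x => f1 (t, x), fun t x => f2 (t, x), fun t x => f3 (t, x), fun t x => f4 (t, x),
    fun t x => g0 (t, x), fun t x => g1 (t, x), fun t x => g2 (t, x), h0.continuous,
    h1.continuous, h2.continuous, h3.continuous, h4.continuous, k0.continuous, k1.continuous,
    k2.continuous, fun t x => hasDerivAt_slice_space (D h0 (by norm_num)) t x,
    fun t x => hasDerivAt_slice_space (D h1 (by norm_num)) t x,
    fun t x => hasDerivAt_slice_space (D h2 (by norm_num)) t x,
    fun t x => hasDerivAt_slice_space (D h3 (by norm_num)) t x,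
    fun t x => ?_, fun t x => ?_, fun t x => hasDerivAt_slice_time (D h0 (by norm_num)) t x,
    fun t x => hasDerivAt_slice_time (D h1 (by norm_num)) t x,
    fun t x => hasDerivAt_slice_time (D h2 (by norm_num)) t x⟩
  · rw [← s1]; exact hasDerivAt_slice_space (D k0 (by norm_num)) t x
  · rw [← s2]; exact hasDerivAt_slice_space (D k1 (by norm_num)) t x

namespace SpaceTimeJet

variable {v0 v1 v2 v3 v4 q0 q1 q2 : ℝ → ℝ → ℝ}

theorem deriv_eq (h : SpaceTimeJet v0 v1 v2 v3 v4 q0 q1 q2) (t : ℝ) : deriv (v0 t) = v1 t :=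
  funext fun x => (h.d0 t x).deriv

theorem iteratedDeriv_two (h : SpaceTimeJet v0 v1 v2 v3 v4 q0 q1 q2) (t : ℝ) :
    iteratedDeriv 2 (v0 t) = v2 t := by
  rw [iteratedDeriv_succ, iteratedDeriv_one, h.deriv_eq]
  exact funext fun x => (h.d1 t x).deriv

theorem iteratedDeriv_three (h : SpaceTimeJet v0 v1 v2 v3 v4 q0 q1 q2) (t : ℝ) :
    iteratedDeriv 3 (v0 t) = v3 t := by
  rw [iteratedDeriv_succ, h.iteratedDeriv_two]
  exact funext fun x => (h.d2 t x).deriv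

theorem iteratedDeriv_four (h : SpaceTimeJet v0 v1 v2 v3 v4 q0 q1 q2) (t : ℝ) :
    iteratedDeriv 4 (v0 t) = v4 t := by
  rw [iteratedDeriv_succ, h.iteratedDeriv_three]
  exact funext fun x => (h.d3 t x).deriv

end SpaceTimeJet

/-- The successive derivatives of the spatial profile of the weight. -/
structure WeightJet (ψ b b1 b2 b3 : ℝ → ℝ) : Prop where
  d0 : ∀ x, HasDerivAt ψ (b x) x
  d1 : ∀ x, HasDerivAt b (b1 x) x
  d2 : ∀ x, HasDerivAt b1 (b2 x) x
  d3 : ∀ x, HasDerivAt b2 (b3 x) x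
  c3 : Continuous b3

namespace WeightJet

variable {ψ b b1 b2 b3 : ℝ → ℝ}

theorem continuous_zero (h : WeightJet ψ b b1 b2 b3) : Continuous ψ :=
  continuous_iff_continuousAt.2 fun x => (h.d0 x).continuousAt

theorem continuous_one (h : WeightJet ψ b b1 b2 b3) : Continuous b :=
  continuous_iff_continuousAt.2 fun x => (h.d1 x).continuousAt

theorem continuous_two (h : WeightJet ψ b b1 b2 b3) : Continuous b1 :=
  continuous_iff_continuousAt.2 fun x => (h.d2 x).continuousAt

theorem continuous_three (h : WeightJet ψ b b1 b2 b3) : Continuous b2 :=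
  continuous_iff_continuousAt.2 fun x => (h.d3 x).continuousAt

end WeightJet

theorem exists_weightJet {ψ : ℝ → ℝ} (hψ : ContDiff ℝ 4 ψ) :
    ∃ b2 b3, WeightJet ψ (deriv ψ) (deriv (deriv ψ)) b2 b3 := by
  have h1 : ContDiff ℝ 3 (deriv ψ) :=
    (contDiff_succ_iff_deriv (n := 3).1 (by norm_num; exact hψ)).2.2
  have h2 : ContDiff ℝ 2 (deriv (deriv ψ)) :=
    (contDiff_succ_iff_deriv (n := 2).1 (by norm_num; exact h1)).2.2
  have h3 : ContDiff ℝ 1 (deriv (deriv (deriv ψ))) :=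
    (contDiff_succ_iff_deriv (n := 1).1 (by norm_num; exact h2)).2.2
  exact ⟨deriv (deriv (deriv ψ)), deriv (deriv (deriv (deriv ψ))),
    fun x => (hψ.differentiable (by norm_num) x).hasDerivAt,
    fun x => (h1.differentiable (by norm_num) x).hasDerivAt,
    fun x => (h2.differentiable (by norm_num) x).hasDerivAt,
    fun x => (h3.differentiable (by norm_num) x).hasDerivAt,
    h3.continuous_deriv (by norm_num)⟩

theorem hasDerivAt_integral_of_continuousOn {f f' : ℝ → ℝ → ℝ} {U : Set ℝ} {t₀ α β : ℝ}
    (hU : IsOpen U) (ht₀ : t₀ ∈ U) (hf : ∀ t ∈ U, Continuous (f t))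
    (hf' : ContinuousOn (Function.uncurry f') (U ×ˢ univ))
    (hd : ∀ t ∈ U, ∀ x, HasDerivAt (fun r => f r x) (f' t x) t) :
    HasDerivAt (fun t => ∫ x in α..β, f t x) (∫ x in α..β, f' t₀ x) t₀ := by
  obtain ⟨ε, hε, hεU⟩ := Metric.nhds_basis_closedBall.mem_iff.1 (hU.mem_nhds ht₀)
  have hcomp : IsCompact (Metric.closedBall t₀ ε ×ˢ uIcc α β) :=
    (isCompact_closedBall _ _).prod isCompact_uIcc
  obtain ⟨B, hB⟩ := hcomp.exists_bound_of_continuousOn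
    (hf'.mono (prod_mono hεU (subset_univ _)))
  have hcf' : Continuous (f' t₀) := by
    have : ContinuousOn (fun x => Function.uncurry f' (t₀, x)) univ :=
      hf'.comp (by fun_prop) (fun x _ => ⟨ht₀, mem_univ _⟩)
    exact continuousOn_univ.1 this
  refine (intervalIntegral.hasDerivAt_integral_of_dominated_loc_of_deriv_le
    (bound := fun _ => B) (Metric.closedBall_mem_nhds t₀ hε) ?_ ?_ ?_ ?_ ?_ ?_).2
  · filter_upwards [hU.mem_nhds ht₀] with t ht using (hf t ht).aestronglyMeasurable
  · exact (hf t₀ ht₀).intervalIntegrable _ _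
  · exact hcf'.aestronglyMeasurable
  · exact Filter.Eventually.of_forall fun x hx t ht => hB (t, x) ⟨ht, uIoc_subset_uIcc hx⟩
  · exact intervalIntegrable_const
  · exact Filter.Eventually.of_forall fun x _ t ht => hd t (hεU ht) x

/-- `e^ℓ v`, with `E = e^ℓ`. -/
def conj0 (E v0 : ℝ) : ℝ := E * v0

/-- `∂_x (e^ℓ v)`, with `E = e^ℓ` and `a = ℓ_x`. -/
def conj1 (E a v0 v1 : ℝ) : ℝ := E * (v1 + a * v0)

/-- `∂_x² (e^ℓ v)`. -/
def conj2 (E a a1 v0 v1 v2 : ℝ) : ℝ := E * (v2 + 2 * a * v1 + (a ^ 2 + a1) * v0)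

/-- `∂_x³ (e^ℓ v)`. -/
def conj3 (E a a1 a2 v0 v1 v2 v3 : ℝ) : ℝ :=
  E * (v3 + 3 * a * v2 + 3 * (a ^ 2 + a1) * v1 + (a ^ 3 + 3 * a * a1 + a2) * v0)

/-- `∂_x⁴ (e^ℓ v)`. -/
def conj4 (E a a1 a2 a3 v0 v1 v2 v3 v4 : ℝ) : ℝ :=
  E * (v4 + 4 * a * v3 + 6 * (a ^ 2 + a1) * v2 + 4 * (a ^ 3 + 3 * a * a1 + a2) * v1
    + (a ^ 4 + 6 * a ^ 2 * a1 + 4 * a * a2 + 3 * a1 ^ 2 + a3) * v0)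

/-- `∂_t (e^ℓ v)`, with `l = ℓ_t`. -/
def conjT0 (E l v0 q0 : ℝ) : ℝ := E * (q0 + l * v0)

/-- `∂_t ∂_x (e^ℓ v)`, with `aₜ = ℓ_{xt}`. -/
def conjT1 (E l a aₜ v0 v1 q0 q1 : ℝ) : ℝ :=
  E * (q1 + a * q0 + aₜ * v0 + l * (v1 + a * v0))

/-- `∂_t ∂_x² (e^ℓ v)`. -/
def conjT2 (E l a a1 aₜ a1ₜ v0 v1 v2 q0 q1 q2 : ℝ) : ℝ :=
  E * (q2 + 2 * a * q1 + (a ^ 2 + a1) * q0 + 2 * aₜ * v1 + (2 * a * aₜ + a1ₜ) * v0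
    + l * (v2 + 2 * a * v1 + (a ^ 2 + a1) * v0))

section Space

variable {E a a1 a2 v0 v1 v2 v3 l lx q0 q1 : ℝ → ℝ} {x a3 v4 q2 lxx : ℝ}

theorem hasDerivAt_conj0 (hE : HasDerivAt E (E x * a x) x) (h0 : HasDerivAt v0 (v1 x) x) :
    HasDerivAt (fun y => conj0 (E y) (v0 y)) (conj1 (E x) (a x) (v0 x) (v1 x)) x := by
  unfold conj0
  refine (hE.mul h0).congr_deriv ?_
  simp only [conj1]; ring

theorem hasDerivAt_conj1 (hE : HasDerivAt E (E x * a x) x) (ha : HasDerivAt a (a1 x) x)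
    (h0 : HasDerivAt v0 (v1 x) x) (h1 : HasDerivAt v1 (v2 x) x) :
    HasDerivAt (fun y => conj1 (E y) (a y) (v0 y) (v1 y))
      (conj2 (E x) (a x) (a1 x) (v0 x) (v1 x) (v2 x)) x := by
  unfold conj1
  refine (hE.mul (h1.add (ha.mul h0))).congr_deriv ?_
  simp only [conj2, Pi.mul_apply, Pi.add_apply]; ring

theorem hasDerivAt_conj2 (hE : HasDerivAt E (E x * a x) x) (ha : HasDerivAt a (a1 x) x)
    (ha1 : HasDerivAt a1 (a2 x) x)
    (h0 : HasDerivAt v0 (v1 x) x) (h1 : HasDerivAt v1 (v2 x) x) (h2 : HasDerivAt v2 (v3 x) x) :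
    HasDerivAt (fun y => conj2 (E y) (a y) (a1 y) (v0 y) (v1 y) (v2 y))
      (conj3 (E x) (a x) (a1 x) (a2 x) (v0 x) (v1 x) (v2 x) (v3 x)) x := by
  unfold conj2
  refine (hE.mul ((h2.add ((ha.const_mul 2).mul h1)).add
    (((ha.pow 2).add ha1).mul h0))).congr_deriv ?_
  simp only [conj3, Pi.mul_apply, Pi.add_apply, Pi.pow_apply]; push_cast; ring

theorem hasDerivAt_conj3 (hE : HasDerivAt E (E x * a x) x) (ha : HasDerivAt a (a1 x) x)
    (ha1 : HasDerivAt a1 (a2 x) x) (ha2 : HasDerivAt a2 a3 x)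
    (h0 : HasDerivAt v0 (v1 x) x) (h1 : HasDerivAt v1 (v2 x) x) (h2 : HasDerivAt v2 (v3 x) x)
    (h3 : HasDerivAt v3 v4 x) :
    HasDerivAt (fun y => conj3 (E y) (a y) (a1 y) (a2 y) (v0 y) (v1 y) (v2 y) (v3 y))
      (conj4 (E x) (a x) (a1 x) (a2 x) a3 (v0 x) (v1 x) (v2 x) (v3 x) v4) x := by
  unfold conj3
  refine (hE.mul (((h3.add ((ha.const_mul 3).mul h2)).add
    ((((ha.pow 2).add ha1).const_mul 3).mul h1)).add
    ((((ha.pow 3).add ((ha.const_mul 3).mul ha1)).add ha2).mul h0))).congr_deriv ?_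
  simp only [conj4, Pi.mul_apply, Pi.add_apply, Pi.pow_apply]; push_cast; ring

theorem hasDerivAt_conjT0_space (hE : HasDerivAt E (E x * a x) x) (hl : HasDerivAt l (lx x) x)
    (h0 : HasDerivAt v0 (v1 x) x) (hq0 : HasDerivAt q0 (q1 x) x) :
    HasDerivAt (fun y => conjT0 (E y) (l y) (v0 y) (q0 y))
      (conjT1 (E x) (l x) (a x) (lx x) (v0 x) (v1 x) (q0 x) (q1 x)) x := by
  unfold conjT0
  refine (hE.mul (hq0.add (hl.mul h0))).congr_deriv ?_
  simp only [conjT1, Pi.mul_apply, Pi.add_apply]; ring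

theorem hasDerivAt_conjT1_space (hE : HasDerivAt E (E x * a x) x) (ha : HasDerivAt a (a1 x) x)
    (hl : HasDerivAt l (lx x) x) (hlx : HasDerivAt lx lxx x)
    (h0 : HasDerivAt v0 (v1 x) x) (h1 : HasDerivAt v1 (v2 x) x)
    (hq0 : HasDerivAt q0 (q1 x) x) (hq1 : HasDerivAt q1 q2 x) :
    HasDerivAt (fun y => conjT1 (E y) (l y) (a y) (lx y) (v0 y) (v1 y) (q0 y) (q1 y))
      (conjT2 (E x) (l x) (a x) (a1 x) (lx x) lxx (v0 x) (v1 x) (v2 x) (q0 x) (q1 x) q2) x := by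
  unfold conjT1
  refine (hE.mul (((hq1.add (ha.mul hq0)).add (hlx.mul h0)).add
    (hl.mul (h1.add (ha.mul h0))))).congr_deriv ?_
  simp only [conjT2, Pi.mul_apply, Pi.add_apply]; ring

end Space

section Time

variable {E a a1 v0 v1 v2 : ℝ → ℝ} {t l aₜ a1ₜ q0 q1 q2 : ℝ}

theorem hasDerivAt_conj0_time (hE : HasDerivAt E (E t * l) t) (h0 : HasDerivAt v0 q0 t) :
    HasDerivAt (fun r => conj0 (E r) (v0 r)) (conjT0 (E t) l (v0 t) q0) t := by
  unfold conj0
  refine (hE.mul h0).congr_deriv ?_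
  simp only [conjT0]; ring

theorem hasDerivAt_conj1_time (hE : HasDerivAt E (E t * l) t) (ha : HasDerivAt a aₜ t)
    (h0 : HasDerivAt v0 q0 t) (h1 : HasDerivAt v1 q1 t) :
    HasDerivAt (fun r => conj1 (E r) (a r) (v0 r) (v1 r))
      (conjT1 (E t) l (a t) aₜ (v0 t) (v1 t) q0 q1) t := by
  unfold conj1
  refine (hE.mul (h1.add (ha.mul h0))).congr_deriv ?_
  simp only [conjT1, Pi.mul_apply, Pi.add_apply]; ring

theorem hasDerivAt_conj2_time (hE : HasDerivAt E (E t * l) t) (ha : HasDerivAt a aₜ t)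
    (ha1 : HasDerivAt a1 a1ₜ t)
    (h0 : HasDerivAt v0 q0 t) (h1 : HasDerivAt v1 q1 t) (h2 : HasDerivAt v2 q2 t) :
    HasDerivAt (fun r => conj2 (E r) (a r) (a1 r) (v0 r) (v1 r) (v2 r))
      (conjT2 (E t) l (a t) (a1 t) aₜ a1ₜ (v0 t) (v1 t) (v2 t) q0 q1 q2) t := by
  unfold conj2
  refine (hE.mul ((h2.add ((ha.const_mul 2).mul h1)).add
    (((ha.pow 2).add ha1).mul h0))).congr_deriv ?_
  simp only [conjT2, Pi.mul_apply, Pi.add_apply, Pi.pow_apply]; push_cast; ring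

end Time

theorem conj_operator_eq (E γ l a a1 a2 a3 v0 v1 v2 v3 v4 q0 : ℝ) :
    E * (γ * q0 + v4) =
      carlemanSym a a1 (conj0 E v0) (conj1 E a v0 v1) (conj2 E a a1 v0 v1 v2)
        (conj4 E a a1 a2 a3 v0 v1 v2 v3 v4)
      + (γ * conjT0 E l v0 q0
        + carlemanSkew a a1 (conj0 E v0) (conj1 E a v0 v1) (conj3 E a a1 a2 v0 v1 v2 v3))
      + carlemanRem γ l a a1 a2 a3 (conj0 E v0) (conj1 E a v0 v1) (conj2 E a a1 v0 v1 v2) := by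
  simp only [carlemanSym, carlemanSkew, carlemanRem, conj0, conj1, conj2, conj3, conj4, conjT0]
  ring

theorem weightedSq_smul (τ E u0 u1 u2 u3 : ℝ) :
    weightedSq τ (E * u0) (E * u1) (E * u2) (E * u3) = E ^ 2 * weightedSq τ u0 u1 u2 u3 := by
  unfold weightedSq; ring

/-- The energy density of the symmetric part. -/
noncomputable def energyDensity (a w0 w1 w2 : ℝ) : ℝ := (w2 ^ 2 - 6 * a ^ 2 * w1 ^ 2 + a ^ 4 * w0 ^ 2) / 2

/-- The time derivative of `γ` times the energy density. -/
def energyDensityDeriv (γ a aₜ w0 w1 w2 p0 p1 p2 : ℝ) : ℝ :=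
  γ * (w2 * p2 - 6 * a ^ 2 * w1 * p1 + a ^ 4 * w0 * p0) + energyCoeffDeriv γ a aₜ w0 w1

theorem hasDerivAt_energyDensity {a w0 w1 w2 : ℝ → ℝ} {γ t aₜ p0 p1 p2 : ℝ}
    (ha : HasDerivAt a aₜ t) (h0 : HasDerivAt w0 p0 t) (h1 : HasDerivAt w1 p1 t)
    (h2 : HasDerivAt w2 p2 t) :
    HasDerivAt (fun r => γ * energyDensity (a r) (w0 r) (w1 r) (w2 r))
      (energyDensityDeriv γ (a t) aₜ (w0 t) (w1 t) (w2 t) p0 p1 p2) t := by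
  unfold energyDensity
  refine (((((h2.pow 2).sub (((ha.pow 2).const_mul 6).mul (h1.pow 2))).add
    ((ha.pow 4).mul (h0.pow 2))).div_const 2).const_mul γ).congr_deriv ?_
  simp only [energyDensityDeriv, energyCoeffDeriv, Pi.pow_apply]; push_cast; ring

/-- The pointwise Carleman inequality, in terms of the original function. -/
theorem carleman_pointwise_conj {M γ κ ψ b b1 b2 b3 τ δ : ℝ}
    (h : WeightBound M γ κ ψ b b1 b2 b3) (hδ : 0 < δ) (hδ1 : δ ≤ 1)
    (hτ : 1 + 1000 * M ^ 6 / δ ^ 4 ≤ τ) {E v0 v1 v2 v3 v4 q0 w0 w1 w2 w3 w4 p0 p1 p2 : ℝ}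
    (hw0 : w0 = conj0 E v0) (hw1 : w1 = conj1 E (τ * b) v0 v1)
    (hw2 : w2 = conj2 E (τ * b) (τ * b1) v0 v1 v2)
    (hw3 : w3 = conj3 E (τ * b) (τ * b1) (τ * b2) v0 v1 v2 v3)
    (hw4 : w4 = conj4 E (τ * b) (τ * b1) (τ * b2) (τ * b3) v0 v1 v2 v3 v4)
    (hp0 : p0 = conjT0 E (κ * τ ^ 2 * ψ) v0 q0) {S : Prop} [Decidable S]
    (hS : ¬ S → δ ≤ b1 ∧ δ ≤ b ^ 2) :
    carlemanFluxDeriv γ (τ * b) (τ * b1) (τ * b2) w0 w1 w2 w3 w4 p0 p1 p2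
      + energyDensityDeriv γ (τ * b) (κ * τ ^ 2 * b) w0 w1 w2 p0 p1 p2
      ≤ E ^ 2 * (γ * q0 + v4) ^ 2 / 2
        - δ ^ 4 / (1600 * M ^ 6) * (E ^ 2 * (τ * weightedSq τ v0 v1 v2 v3))
        + (if S then (δ ^ 4 / (1600 * M ^ 6) + 1060 * M ^ 7 * (1600 * M ^ 6))
            * (E ^ 2 * (τ * weightedSq τ v0 v1 v2 v3)) else 0) := by
  have hM := h.one_le
  have hM6 : 0 < 1600 * M ^ 6 := by positivity
  have hτ1 : 1 ≤ τ := le_trans (by have : 0 ≤ 1000 * M ^ 6 / δ ^ 4 := by positivity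
                                   linarith) hτ
  have hpt := carleman_pointwise h hτ1 w0 w1 w2 w3 w4 p0 p1 p2 (E * (γ * q0 + v4)) (by
    rw [conj_operator_eq E γ (κ * τ ^ 2 * ψ) (τ * b) (τ * b1) (τ * b2) (τ * b3) v0 v1 v2 v3 v4 q0,
      hw0, hw1, hw2, hw3, hw4, hp0])
  have hN : weightedSq τ w0 w1 w2 w3 = E ^ 2 * weightedSq τ v0 (v1 + τ * b * v0)
        (v2 + 2 * (τ * b) * v1 + ((τ * b) ^ 2 + τ * b1) * v0)
        (v3 + 3 * (τ * b) * v2 + 3 * ((τ * b) ^ 2 + τ * b1) * v1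
          + ((τ * b) ^ 3 + 3 * (τ * b) * (τ * b1) + τ * b2) * v0) := by
    rw [← weightedSq_smul, hw0, hw1, hw2, hw3]; rfl
  have n1 : weightedSq τ w0 w1 w2 w3 ≤ 1600 * M ^ 6 * (E ^ 2 * weightedSq τ v0 v1 v2 v3) := by
    rw [hN]
    have := mul_le_mul_of_nonneg_left
      (weightedSq_conj_le hM h.hb h.hb1 h.hb2 hτ1 v0 v1 v2 v3) (sq_nonneg E)
    linarith
  have n2 : E ^ 2 * weightedSq τ v0 v1 v2 v3 ≤ 1600 * M ^ 6 * weightedSq τ w0 w1 w2 w3 := by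
    rw [hN]
    have := mul_le_mul_of_nonneg_left
      (weightedSq_le_conj hM h.hb h.hb1 h.hb2 hτ1 v0 v1 v2 v3) (sq_nonneg E)
    linarith
  have hτ0 : 0 < τ := by linarith
  unfold energyDensityDeriv
  split_ifs with hs
  · have u := carleman_pointwise_upper h hτ1 w0 w1 w2 w3
    have : 1060 * M ^ 7 * (τ * weightedSq τ w0 w1 w2 w3) ≤
        1060 * M ^ 7 * (τ * (1600 * M ^ 6 * (E ^ 2 * weightedSq τ v0 v1 v2 v3))) := by gcongr
    linarith
  · have u := carleman_pointwise_lower h hδ hδ1 hτ w0 w1 w2 w3 (hS hs).1 (hS hs).2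
    have : δ ^ 4 / (1600 * M ^ 6) * (τ * (E ^ 2 * weightedSq τ v0 v1 v2 v3))
        ≤ δ ^ 4 / (1600 * M ^ 6) * (τ * (1600 * M ^ 6 * weightedSq τ w0 w1 w2 w3)) := by gcongr
    have e : δ ^ 4 / (1600 * M ^ 6) * (τ * (1600 * M ^ 6 * weightedSq τ w0 w1 w2 w3))
        = δ ^ 4 * (τ * weightedSq τ w0 w1 w2 w3) := by
      field_simp
    linarith

section Slice

variable (τ κ : ℝ) (ψ b b1 v0 v1 v2 q0 q1 q2 : ℝ → ℝ) (x : ℝ)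

/-- The conjugated function `e^{τψ} v`. -/
noncomputable def sliceW0 : ℝ := conj0 (exp (τ * ψ x)) (v0 x)

/-- The first space derivative of the conjugated function. -/
noncomputable def sliceW1 : ℝ := conj1 (exp (τ * ψ x)) (τ * b x) (v0 x) (v1 x)

/-- The second space derivative of the conjugated function. -/
noncomputable def sliceW2 : ℝ :=
  conj2 (exp (τ * ψ x)) (τ * b x) (τ * b1 x) (v0 x) (v1 x) (v2 x)

/-- The time derivative of the conjugated function, when `τ' = κτ²`. -/
noncomputable def sliceP0 : ℝ := conjT0 (exp (τ * ψ x)) (κ * τ ^ 2 * ψ x) (v0 x) (q0 x)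

/-- The time derivative of `sliceW1`. -/
noncomputable def sliceP1 : ℝ :=
  conjT1 (exp (τ * ψ x)) (κ * τ ^ 2 * ψ x) (τ * b x) (κ * τ ^ 2 * b x) (v0 x) (v1 x) (q0 x) (q1 x)

/-- The time derivative of `sliceW2`. -/
noncomputable def sliceP2 : ℝ :=
  conjT2 (exp (τ * ψ x)) (κ * τ ^ 2 * ψ x) (τ * b x) (τ * b1 x) (κ * τ ^ 2 * b x)
    (κ * τ ^ 2 * b1 x) (v0 x) (v1 x) (v2 x) (q0 x) (q1 x) (q2 x)

/-- The time derivative of `a w_x²`. -/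
noncomputable def sliceBoundary : ℝ :=
  κ * τ ^ 2 * b x * sliceW1 τ ψ b v0 v1 x ^ 2
    + τ * b x * (2 * sliceW1 τ ψ b v0 v1 x * sliceP1 τ κ ψ b v0 v1 q0 q1 x)

/-- The time derivative of the energy density. -/
noncomputable def sliceEnergyDeriv (γ : ℝ) : ℝ :=
  energyDensityDeriv γ (τ * b x) (κ * τ ^ 2 * b x) (sliceW0 τ ψ v0 x) (sliceW1 τ ψ b v0 v1 x)
    (sliceW2 τ ψ b b1 v0 v1 v2 x) (sliceP0 τ κ ψ v0 q0 x) (sliceP1 τ κ ψ b v0 v1 q0 q1 x)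
    (sliceP2 τ κ ψ b b1 v0 v1 v2 q0 q1 q2 x)

end Slice

theorem carleman_slice {ψ b b1 b2 b3 v0 v1 v2 v3 v4 q0 q1 q2 J : ℝ → ℝ}
    {L M γ κ τ δ k₁ k₂ : ℝ} {ω₀ : Set ℝ} (hL : 0 < L) (hψ : WeightJet ψ b b1 b2 b3)
    (hW : ∀ x ∈ Icc 0 L, WeightBound M γ κ (ψ x) (b x) (b1 x) (b2 x) (b3 x))
    (hδ : 0 < δ) (hδ1 : δ ≤ 1)
    (hτ : 1 + 1000 * M ^ 6 / δ ^ 4 ≤ τ) (hτ' : 1 + 61 * M ^ 4 / (48 * δ ^ 5) ≤ τ)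
    (hω : IsOpen ω₀) (hωL : ω₀ ⊆ Ioo 0 L)
    (hgood : ∀ x ∈ Icc 0 L \ ω₀, δ ≤ b1 x ∧ δ ≤ b x ^ 2) (hb0 : δ ≤ b 0) (hbL : b L ≤ -δ)
    (h0 : ∀ x, HasDerivAt v0 (v1 x) x) (h1 : ∀ x, HasDerivAt v1 (v2 x) x)
    (h2 : ∀ x, HasDerivAt v2 (v3 x) x) (h3 : ∀ x, HasDerivAt v3 (v4 x) x) (c4 : Continuous v4)
    (hq0 : ∀ x, HasDerivAt q0 (q1 x) x) (hq1 : ∀ x, HasDerivAt q1 (q2 x) x)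
    (cq2 : Continuous q2)
    (bd : ∀ x, x = 0 ∨ x = L → v0 x = 0 ∧ q0 x = 0 ∧ ((v1 x = 0 ∧ q1 x = 0) ∨ v2 x = 0))
    (hJ : Continuous J)
    (hJ1 : ∀ x ∈ Icc 0 L,
      k₁ * J x ≤ exp (τ * ψ x) ^ 2 * (τ * weightedSq τ (v0 x) (v1 x) (v2 x) (v3 x)))
    (hJ2 : ∀ x ∈ Icc 0 L,
      exp (τ * ψ x) ^ 2 * (τ * weightedSq τ (v0 x) (v1 x) (v2 x) (v3 x)) ≤ k₂ * J x) :
    (∫ x in (0:ℝ)..L, sliceEnergyDeriv τ κ ψ b b1 v0 v1 v2 q0 q1 q2 x γ)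
      - γ * sliceBoundary τ κ ψ b v0 v1 q0 q1 L + γ * sliceBoundary τ κ ψ b v0 v1 q0 q1 0
    ≤ 1 / 2 * (∫ x in Ioo 0 L, exp (τ * ψ x) ^ 2 * (γ * q0 x + v4 x) ^ 2)
      - δ ^ 4 / (1600 * M ^ 6) * k₁ * (∫ x in Ioo 0 L, J x)
      + (δ ^ 4 / (1600 * M ^ 6) + 1060 * M ^ 7 * (1600 * M ^ 6)) * k₂ * (∫ x in ω₀, J x) := by
  classical
  have hM : 1 ≤ M := (hW 0 ⟨le_rfl, hL.le⟩).one_le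
  have cψ := hψ.continuous_zero
  have cb := hψ.continuous_one
  have cb1 := hψ.continuous_two
  have cb2 := hψ.continuous_three
  have cb3 := hψ.c3
  have cont : ∀ {f f' : ℝ → ℝ}, (∀ x, HasDerivAt f (f' x) x) → Continuous f := fun h =>
    continuous_iff_continuousAt.2 fun x => (h x).continuousAt
  have c0 := cont h0
  have c1 := cont h1
  have c2 := cont h2
  have c3 := cont h3
  have cq0 := cont hq0
  have cq1 := cont hq1
  set w0 := sliceW0 τ ψ v0 with hw0
  set w1 := sliceW1 τ ψ b v0 v1 with hw1
  set w2 := sliceW2 τ ψ b b1 v0 v1 v2 with hw2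
  set w3 : ℝ → ℝ := fun x => conj3 (exp (τ * ψ x)) (τ * b x) (τ * b1 x) (τ * b2 x)
    (v0 x) (v1 x) (v2 x) (v3 x) with hw3
  set w4 : ℝ → ℝ := fun x => conj4 (exp (τ * ψ x)) (τ * b x) (τ * b1 x) (τ * b2 x) (τ * b3 x)
    (v0 x) (v1 x) (v2 x) (v3 x) (v4 x) with hw4
  set p0 := sliceP0 τ κ ψ v0 q0 with hp0
  set p1 := sliceP1 τ κ ψ b v0 v1 q0 q1 with hp1
  set p2 := sliceP2 τ κ ψ b b1 v0 v1 v2 q0 q1 q2 with hp2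
  have dE : ∀ x, HasDerivAt (fun y => exp (τ * ψ y)) (exp (τ * ψ x) * (τ * b x)) x :=
    fun x => ((hψ.d0 x).const_mul τ).exp
  have da : ∀ x, HasDerivAt (fun y => τ * b y) (τ * b1 x) x := fun x => (hψ.d1 x).const_mul τ
  have da1 : ∀ x, HasDerivAt (fun y => τ * b1 y) (τ * b2 x) x := fun x => (hψ.d2 x).const_mul τ
  have da2 : ∀ x, HasDerivAt (fun y => τ * b2 y) (τ * b3 x) x := fun x => (hψ.d3 x).const_mul τ
  have dl : ∀ x, HasDerivAt (fun y => κ * τ ^ 2 * ψ y) (κ * τ ^ 2 * b x) x :=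
    fun x => (hψ.d0 x).const_mul _
  have dl1 : ∀ x, HasDerivAt (fun y => κ * τ ^ 2 * b y) (κ * τ ^ 2 * b1 x) x :=
    fun x => (hψ.d1 x).const_mul _
  have dw0 : ∀ x, HasDerivAt w0 (w1 x) x := fun x => hasDerivAt_conj0 (a := fun y => τ * b y)
    (dE x) (h0 x)
  have dw1 : ∀ x, HasDerivAt w1 (w2 x) x := fun x => hasDerivAt_conj1 (a := fun y => τ * b y)
    (a1 := fun y => τ * b1 y) (dE x) (da x) (h0 x) (h1 x)
  have dw2 : ∀ x, HasDerivAt w2 (w3 x) x := fun x => hasDerivAt_conj2 (a := fun y => τ * b y)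
    (a1 := fun y => τ * b1 y) (a2 := fun y => τ * b2 y)
    (dE x) (da x) (da1 x) (h0 x) (h1 x) (h2 x)
  have dw3 : ∀ x, HasDerivAt w3 (w4 x) x := fun x => hasDerivAt_conj3 (a := fun y => τ * b y)
    (a1 := fun y => τ * b1 y) (a2 := fun y => τ * b2 y)
    (dE x) (da x) (da1 x) (da2 x) (h0 x) (h1 x) (h2 x) (h3 x)
  have dp0 : ∀ x, HasDerivAt p0 (p1 x) x := fun x =>
    hasDerivAt_conjT0_space (a := fun y => τ * b y) (l := fun y => κ * τ ^ 2 * ψ y)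
    (lx := fun y => κ * τ ^ 2 * b y) (dE x) (dl x) (h0 x) (hq0 x)
  have dp1 : ∀ x, HasDerivAt p1 (p2 x) x := fun x =>
    hasDerivAt_conjT1_space (a := fun y => τ * b y) (a1 := fun y => τ * b1 y)
    (l := fun y => κ * τ ^ 2 * ψ y)
    (lx := fun y => κ * τ ^ 2 * b y) (dE x) (da x) (dl x) (dl1 x) (h0 x) (h1 x) (hq0 x) (hq1 x)
  have cw0 := cont dw0
  have cw1 := cont dw1
  have cw2 := cont dw2
  have cw3 := cont dw3
  have cp0 := cont dp0
  have cp1 := cont dp1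
  have cw4 : Continuous w4 := by simp only [hw4, conj4]; fun_prop
  have cp2 : Continuous p2 := by simp only [hp2]; unfold sliceP2 conjT2; fun_prop
  set Q : ℝ → ℝ := fun y => carlemanFlux γ (τ * b y) (τ * b1 y) (w0 y) (w1 y) (w2 y) (w3 y)
    (p0 y) (p1 y) with hQ
  set Q' : ℝ → ℝ := fun y => carlemanFluxDeriv γ (τ * b y) (τ * b1 y) (τ * b2 y) (w0 y) (w1 y)
    (w2 y) (w3 y) (w4 y) (p0 y) (p1 y) (p2 y) with hQ'
  set e : ℝ → ℝ := fun x => sliceEnergyDeriv τ κ ψ b b1 v0 v1 v2 q0 q1 q2 x γ with he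
  have dQ : ∀ x, HasDerivAt Q (Q' x) x := fun x =>
    hasDerivAt_carlemanFlux (a := fun y => τ * b y) (a1 := fun y => τ * b1 y)
      (da x) (da1 x) (dw0 x) (dw1 x) (dw2 x) (dw3 x) (dp0 x) (dp1 x)
  have cQ' : Continuous Q' := by
    simp only [hQ', carlemanFluxDeriv, carlemanSym, carlemanSkew, carlemanForm]; fun_prop
  have ce : Continuous e := by
    have : e = fun x => γ * (w2 x * p2 x - 6 * (τ * b x) ^ 2 * w1 x * p1 x
        + (τ * b x) ^ 4 * w0 x * p0 x)
        + energyCoeffDeriv γ (τ * b x) (κ * τ ^ 2 * b x) (w0 x) (w1 x) := rfl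
    rw [this]; unfold energyCoeffDeriv; fun_prop
  have ftc : ∫ x in (0:ℝ)..L, Q' x = Q L - Q 0 :=
    intervalIntegral.integral_eq_sub_of_hasDerivAt (fun x _ => dQ x) (cQ'.intervalIntegrable _ _)
  have bdw : ∀ x, x = 0 ∨ x = L → w0 x = 0 ∧ p0 x = 0 ∧
      ((w1 x = 0 ∧ p1 x = 0) ∨ w2 x = 2 * (τ * b x) * w1 x) := by
    intro x hx
    obtain ⟨e1, e2, e3⟩ := bd x hx
    refine ⟨?_, ?_, ?_⟩
    · simp [hw0, sliceW0, conj0, e1]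
    · simp [hp0, sliceP0, conjT0, e1, e2]
    · rcases e3 with ⟨e3, e4⟩ | e3
      · left; constructor
        · simp [hw1, sliceW1, conj1, e1, e3]
        · simp [hp1, sliceP1, conjT1, e1, e2, e3, e4]
      · right
        simp only [hw1, hw2, sliceW1, sliceW2, conj1, conj2, e1, e3]; ring
  have B0 : Q 0 + γ * sliceBoundary τ κ ψ b v0 v1 q0 q1 0 ≤ 0 := by
    obtain ⟨e1, e2, e3⟩ := bdw 0 (Or.inl rfl)
    have := carlemanFlux_boundary (w3 := w3 0) (hW 0 ⟨le_rfl, hL.le⟩) hδ (σ := 1) (Or.inl rfl)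
      (by linarith) hτ' e1 e2 e3
    rw [one_mul] at this
    exact this
  have BL : 0 ≤ Q L + γ * sliceBoundary τ κ ψ b v0 v1 q0 q1 L := by
    obtain ⟨e1, e2, e3⟩ := bdw L (Or.inr rfl)
    have := carlemanFlux_boundary (w3 := w3 L) (hW L ⟨hL.le, le_rfl⟩) hδ (σ := -1) (Or.inr rfl)
      (by linarith) hτ' e1 e2 e3
    have h' : -1 * (Q L + γ * sliceBoundary τ κ ψ b v0 v1 q0 q1 L) ≤ 0 := this
    linarith
  set c := δ ^ 4 / (1600 * M ^ 6) with hc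
  set C := c + 1060 * M ^ 7 * (1600 * M ^ 6) with hC
  have hc0 : 0 ≤ c := by positivity
  have hC0 : 0 ≤ C := by positivity
  have pt : ∀ x ∈ Icc 0 L, Q' x + e x ≤
      1 / 2 * (exp (τ * ψ x) ^ 2 * (γ * q0 x + v4 x) ^ 2) - c * k₁ * J x
        + C * k₂ * ω₀.indicator J x := by
    intro x hx
    have H := carleman_pointwise_conj (hW x hx) hδ hδ1 hτ (E := exp (τ * ψ x)) (v0 := v0 x)
      (v1 := v1 x) (v2 := v2 x) (v3 := v3 x) (v4 := v4 x) (q0 := q0 x) (w0 := w0 x) (w1 := w1 x)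
      (w2 := w2 x) (w3 := w3 x) (w4 := w4 x) (p0 := p0 x) (p1 := p1 x) (p2 := p2 x)
      rfl rfl rfl rfl rfl rfl (S := x ∈ ω₀) (fun hn => hgood x ⟨hx, hn⟩)
    refine le_trans H ?_
    have j1 := mul_le_mul_of_nonneg_left (hJ1 x hx) hc0
    have j2 := mul_le_mul_of_nonneg_left (hJ2 x hx) hC0
    rw [← hc, ← hC]
    by_cases hs : x ∈ ω₀
    · rw [if_pos hs, indicator_of_mem hs]; linarith
    · rw [if_neg hs, indicator_of_notMem hs]; linarith
  have iF : IntervalIntegrable (fun x => exp (τ * ψ x) ^ 2 * (γ * q0 x + v4 x) ^ 2)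
    volume 0 L := Continuous.intervalIntegrable (by fun_prop) _ _
  have iJ : IntervalIntegrable J volume 0 L := hJ.intervalIntegrable _ _
  have iω : IntervalIntegrable (ω₀.indicator J) volume 0 L :=
    ⟨iJ.1.indicator hω.measurableSet, iJ.2.indicator hω.measurableSet⟩
  have mono := intervalIntegral.integral_mono_on hL.le
    ((cQ'.intervalIntegrable (μ := volume) 0 L).add (ce.intervalIntegrable 0 L))
    (((iF.const_mul (1 / 2)).sub (iJ.const_mul (c * k₁))).add (iω.const_mul (C * k₂))) pt
  rw [intervalIntegral.integral_add ((iF.const_mul (1 / 2)).sub (iJ.const_mul (c * k₁)))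
      (iω.const_mul (C * k₂)),
    intervalIntegral.integral_sub (iF.const_mul (1 / 2)) (iJ.const_mul (c * k₁)),
    intervalIntegral.integral_add (cQ'.intervalIntegrable (μ := volume) 0 L)
      (ce.intervalIntegrable 0 L), ftc, intervalIntegral.integral_const_mul,
    intervalIntegral.integral_const_mul, intervalIntegral.integral_const_mul] at mono
  have conv : ∀ f : ℝ → ℝ, ∫ x in (0:ℝ)..L, f x = ∫ x in Ioo 0 L, f x := fun f => by
    rw [intervalIntegral.integral_of_le hL.le, integral_Ioc_eq_integral_Ioo]
  rw [conv (fun x => exp (τ * ψ x) ^ 2 * (γ * q0 x + v4 x) ^ 2), conv J,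
    conv (ω₀.indicator J), setIntegral_indicator hω.measurableSet,
    inter_eq_right.2 hωL] at mono
  linarith

/-- The energy of a time slice, corrected by its boundary terms. -/
noncomputable def carlemanEnergy (γ L τ : ℝ) (ψ b b1 v0 v1 v2 : ℝ → ℝ) : ℝ :=
  (∫ x in (0:ℝ)..L, γ * energyDensity (τ * b x) (sliceW0 τ ψ v0 x) (sliceW1 τ ψ b v0 v1 x)
      (sliceW2 τ ψ b b1 v0 v1 v2 x))
    - γ * (τ * b L * sliceW1 τ ψ b v0 v1 L ^ 2) + γ * (τ * b 0 * sliceW1 τ ψ b v0 v1 0 ^ 2)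

theorem continuousOn_sliceEnergyDeriv {X : Type*} [TopologicalSpace X] {S : Set X} (γ : ℝ)
    {τ κ ψ b b1 v0 v1 v2 q0 q1 q2 : X → ℝ} (hτ : ContinuousOn τ S) (hκ : ContinuousOn κ S)
    (hψ : ContinuousOn ψ S) (hb : ContinuousOn b S) (hb1 : ContinuousOn b1 S)
    (h0 : ContinuousOn v0 S) (h1 : ContinuousOn v1 S) (h2 : ContinuousOn v2 S)
    (hq0 : ContinuousOn q0 S) (hq1 : ContinuousOn q1 S) (hq2 : ContinuousOn q2 S) :
    ContinuousOn (fun p => sliceEnergyDeriv (τ p) (κ p) (fun _ => ψ p) (fun _ => b p)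
      (fun _ => b1 p) (fun _ => v0 p) (fun _ => v1 p) (fun _ => v2 p) (fun _ => q0 p)
      (fun _ => q1 p) (fun _ => q2 p) (0 : ℝ) γ) S := by
  have cE : ContinuousOn (fun p => exp (τ p * ψ p)) S := (hτ.mul hψ).rexp
  have w0 : ContinuousOn (fun p => conj0 (exp (τ p * ψ p)) (v0 p)) S := by
    unfold conj0; fun_prop
  have w1 : ContinuousOn (fun p => conj1 (exp (τ p * ψ p)) (τ p * b p) (v0 p) (v1 p)) S := by
    unfold conj1; fun_prop
  have w2 : ContinuousOn (fun p => conj2 (exp (τ p * ψ p)) (τ p * b p) (τ p * b1 p) (v0 p) (v1 p)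
      (v2 p)) S := by
    unfold conj2; fun_prop
  have p0 : ContinuousOn (fun p => conjT0 (exp (τ p * ψ p)) (κ p * τ p ^ 2 * ψ p) (v0 p)
      (q0 p)) S := by
    unfold conjT0; fun_prop
  have p1 : ContinuousOn (fun p => conjT1 (exp (τ p * ψ p)) (κ p * τ p ^ 2 * ψ p) (τ p * b p)
      (κ p * τ p ^ 2 * b p) (v0 p) (v1 p) (q0 p) (q1 p)) S := by
    unfold conjT1; fun_prop
  have p2 : ContinuousOn (fun p => conjT2 (exp (τ p * ψ p)) (κ p * τ p ^ 2 * ψ p) (τ p * b p)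
      (τ p * b1 p) (κ p * τ p ^ 2 * b p) (κ p * τ p ^ 2 * b1 p) (v0 p) (v1 p) (v2 p) (q0 p)
      (q1 p) (q2 p)) S := by
    unfold conjT2; fun_prop
  unfold sliceEnergyDeriv energyDensityDeriv energyCoeffDeriv sliceW0 sliceW1 sliceW2 sliceP0
    sliceP1 sliceP2
  fun_prop

theorem hasDerivAt_carlemanEnergy {γ L : ℝ} {ψ b b1 b2 b3 : ℝ → ℝ}
    {v0 v1 v2 v3 v4 q0 q1 q2 : ℝ → ℝ → ℝ} {τ κ : ℝ → ℝ} {U : Set ℝ} {t₀ : ℝ}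
    (hψ : WeightJet ψ b b1 b2 b3) (hv : SpaceTimeJet v0 v1 v2 v3 v4 q0 q1 q2)
    (hU : IsOpen U) (ht₀ : t₀ ∈ U) (hτ : ∀ t ∈ U, HasDerivAt τ (κ t * τ t ^ 2) t)
    (hκ : ContinuousOn κ U) :
    HasDerivAt (fun t => carlemanEnergy γ L (τ t) ψ b b1 (v0 t) (v1 t) (v2 t))
      ((∫ x in (0:ℝ)..L, sliceEnergyDeriv (τ t₀) (κ t₀) ψ b b1 (v0 t₀) (v1 t₀) (v2 t₀)
          (q0 t₀) (q1 t₀) (q2 t₀) x γ)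
        - γ * sliceBoundary (τ t₀) (κ t₀) ψ b (v0 t₀) (v1 t₀) (q0 t₀) (q1 t₀) L
        + γ * sliceBoundary (τ t₀) (κ t₀) ψ b (v0 t₀) (v1 t₀) (q0 t₀) (q1 t₀) 0) t₀ := by
  have cψ := hψ.continuous_zero
  have cb := hψ.continuous_one
  have cb1 := hψ.continuous_two
  have dE : ∀ t ∈ U, ∀ x, HasDerivAt (fun r => exp (τ r * ψ x))
      (exp (τ t * ψ x) * (κ t * τ t ^ 2 * ψ x)) t := fun t ht x => ((hτ t ht).mul_const (ψ x)).exp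
  have da : ∀ t ∈ U, ∀ x, HasDerivAt (fun r => τ r * b x) (κ t * τ t ^ 2 * b x) t :=
    fun t ht x => (hτ t ht).mul_const _
  have da1 : ∀ t ∈ U, ∀ x, HasDerivAt (fun r => τ r * b1 x) (κ t * τ t ^ 2 * b1 x) t :=
    fun t ht x => (hτ t ht).mul_const _
  have dw0 : ∀ t ∈ U, ∀ x, HasDerivAt (fun r => sliceW0 (τ r) ψ (v0 r) x)
      (sliceP0 (τ t) (κ t) ψ (v0 t) (q0 t) x) t := fun t ht x =>
    hasDerivAt_conj0_time (E := fun r => exp (τ r * ψ x)) (dE t ht x) (hv.e0 t x)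
  have dw1 : ∀ t ∈ U, ∀ x, HasDerivAt (fun r => sliceW1 (τ r) ψ b (v0 r) (v1 r) x)
      (sliceP1 (τ t) (κ t) ψ b (v0 t) (v1 t) (q0 t) (q1 t) x) t := fun t ht x =>
    hasDerivAt_conj1_time (E := fun r => exp (τ r * ψ x)) (a := fun r => τ r * b x)
      (dE t ht x) (da t ht x) (hv.e0 t x) (hv.e1 t x)
  have dw2 : ∀ t ∈ U, ∀ x, HasDerivAt (fun r => sliceW2 (τ r) ψ b b1 (v0 r) (v1 r) (v2 r) x)
      (sliceP2 (τ t) (κ t) ψ b b1 (v0 t) (v1 t) (v2 t) (q0 t) (q1 t) (q2 t) x) t := fun t ht x =>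
    hasDerivAt_conj2_time (E := fun r => exp (τ r * ψ x)) (a := fun r => τ r * b x)
      (a1 := fun r => τ r * b1 x)
      (dE t ht x) (da t ht x) (da1 t ht x) (hv.e0 t x) (hv.e1 t x) (hv.e2 t x)
  have dB : ∀ x, HasDerivAt (fun r => τ r * b x * sliceW1 (τ r) ψ b (v0 r) (v1 r) x ^ 2)
      (sliceBoundary (τ t₀) (κ t₀) ψ b (v0 t₀) (v1 t₀) (q0 t₀) (q1 t₀) x) t₀ := by
    intro x
    refine ((da t₀ ht₀ x).mul ((dw1 t₀ ht₀ x).pow 2)).congr_deriv ?_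
    simp only [sliceBoundary, Pi.pow_apply]; push_cast; ring
  have cs : ∀ {f : ℝ → ℝ → ℝ}, Continuous (Function.uncurry f) → ∀ t, Continuous (f t) :=
    fun h t => h.comp (by fun_prop : Continuous fun x => (t, x))
  suffices HI : HasDerivAt (fun t => ∫ x in (0:ℝ)..L, γ * energyDensity (τ t * b x)
      (sliceW0 (τ t) ψ (v0 t) x) (sliceW1 (τ t) ψ b (v0 t) (v1 t) x)
      (sliceW2 (τ t) ψ b b1 (v0 t) (v1 t) (v2 t) x))
      (∫ x in (0:ℝ)..L, sliceEnergyDeriv (τ t₀) (κ t₀) ψ b b1 (v0 t₀) (v1 t₀) (v2 t₀)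
          (q0 t₀) (q1 t₀) (q2 t₀) x γ) t₀ from
    (HI.sub ((dB L).const_mul γ)).add ((dB 0).const_mul γ)
  refine hasDerivAt_integral_of_continuousOn (f' := fun t x => sliceEnergyDeriv (τ t) (κ t) ψ b b1
    (v0 t) (v1 t) (v2 t) (q0 t) (q1 t) (q2 t) x γ) hU ht₀ ?_ ?_ ?_
  · intro t _
    have := cs hv.c0 t
    have := cs hv.c1 t
    have := cs hv.c2 t
    unfold energyDensity sliceW0 sliceW1 sliceW2 conj0 conj1 conj2
    fun_prop
  · have cτ : ContinuousOn (fun p : ℝ × ℝ => τ p.1) (U ×ˢ univ) :=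
      ContinuousOn.comp (t := U) (fun t ht => (hτ t ht).continuousAt.continuousWithinAt)
        continuousOn_fst (fun p hp => hp.1)
    have cκ : ContinuousOn (fun p : ℝ × ℝ => κ p.1) (U ×ˢ univ) :=
      hκ.comp continuousOn_fst (fun p hp => hp.1)
    have k0 : ContinuousOn (fun p : ℝ × ℝ => v0 p.1 p.2) (U ×ˢ univ) := hv.c0.continuousOn
    have k1 : ContinuousOn (fun p : ℝ × ℝ => v1 p.1 p.2) (U ×ˢ univ) := hv.c1.continuousOn
    have k2 : ContinuousOn (fun p : ℝ × ℝ => v2 p.1 p.2) (U ×ˢ univ) := hv.c2.continuousOn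
    have l0 : ContinuousOn (fun p : ℝ × ℝ => q0 p.1 p.2) (U ×ˢ univ) := hv.cq0.continuousOn
    have l1 : ContinuousOn (fun p : ℝ × ℝ => q1 p.1 p.2) (U ×ˢ univ) := hv.cq1.continuousOn
    have l2 : ContinuousOn (fun p : ℝ × ℝ => q2 p.1 p.2) (U ×ˢ univ) := hv.cq2.continuousOn
    have e0 : ContinuousOn (fun p : ℝ × ℝ => ψ p.2) (U ×ˢ univ) := by fun_prop
    have e1 : ContinuousOn (fun p : ℝ × ℝ => b p.2) (U ×ˢ univ) := by fun_prop
    have e2 : ContinuousOn (fun p : ℝ × ℝ => b1 p.2) (U ×ˢ univ) := by fun_prop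
    exact continuousOn_sliceEnergyDeriv γ cτ cκ e0 e1 e2 k0 k1 k2 l0 l1 l2
  · intro t ht x
    exact hasDerivAt_energyDensity (a := fun r => τ r * b x) (da t ht x) (dw0 t ht x) (dw1 t ht x)
      (dw2 t ht x)

theorem exp_neg_mul_pow_le {c τ : ℝ} (hc : 0 < c) (hτ : 0 ≤ τ) (n : ℕ) :
    exp (-(c * τ)) * τ ^ n ≤ n.factorial / c ^ n := by
  have h := pow_div_factorial_le_exp (c * τ) (by positivity) n
  rw [exp_neg, inv_mul_le_iff₀ (exp_pos _)]
  rw [mul_pow] at h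
  calc τ ^ n = (n.factorial / c ^ n) * (c ^ n * τ ^ n / n.factorial) := by
        have : (n.factorial : ℝ) ≠ 0 := by exact_mod_cast n.factorial_ne_zero
        field_simp
    _ ≤ (n.factorial / c ^ n) * exp (c * τ) := by gcongr
    _ = _ := by ring

theorem abs_carlemanEnergy_le {γ L τ M V c : ℝ} {ψ b b1 v0 v1 v2 : ℝ → ℝ} (hL : 0 < L)
    (hM : 1 ≤ M) (hγ : |γ| ≤ M) (hc : 0 < c) (hτ : 1 ≤ τ) (hψ : ∀ x ∈ Icc 0 L, ψ x ≤ -c)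
    (hb : ∀ x ∈ Icc 0 L, |b x| ≤ M) (hb1 : ∀ x ∈ Icc 0 L, |b1 x| ≤ M)
    (h0 : ∀ x ∈ Icc 0 L, |v0 x| ≤ V) (h1 : ∀ x ∈ Icc 0 L, |v1 x| ≤ V)
    (h2 : ∀ x ∈ Icc 0 L, |v2 x| ≤ V) :
    |carlemanEnergy γ L τ ψ b b1 v0 v1 v2| * τ
      ≤ (25 * L + 8) * M ^ 5 * V ^ 2 * (120 / (2 * c) ^ 5) := by
  have hM0 : 0 ≤ M := by linarith
  have hτ0 : 0 ≤ τ := by linarith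
  have hV : 0 ≤ V := (abs_nonneg _).trans (h0 0 ⟨le_rfl, hL.le⟩)
  set E := exp (-(c * τ)) with hE
  have hE0 : 0 < E := exp_pos _
  have bE : ∀ x ∈ Icc 0 L, |exp (τ * ψ x)| ≤ E := fun x hx => by
    rw [abs_of_pos (exp_pos _)]
    exact exp_le_exp.2 (by nlinarith [hψ x hx])
  have b0 : ∀ x ∈ Icc 0 L, |sliceW0 τ ψ v0 x| ≤ E * V := fun x hx => by
    unfold sliceW0 conj0
    rw [abs_mul]
    exact mul_le_mul (bE x hx) (h0 x hx) (abs_nonneg _) hE0.le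
  have ba : ∀ x ∈ Icc 0 L, |τ * b x| ≤ M * τ := fun x hx => by
    rw [abs_mul, abs_of_nonneg hτ0, mul_comm]
    exact mul_le_mul_of_nonneg_right (hb x hx) hτ0
  have hMτ : 1 ≤ M * τ := by nlinarith
  have bw1 : ∀ x ∈ Icc 0 L, |sliceW1 τ ψ b v0 v1 x| ≤ E * (2 * M * τ * V) := fun x hx => by
    unfold sliceW1 conj1
    rw [abs_mul]
    refine mul_le_mul (bE x hx) ?_ (abs_nonneg _) hE0.le
    calc |v1 x + τ * b x * v0 x| ≤ |v1 x| + |τ * b x| * |v0 x| := by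
          rw [← abs_mul]; exact abs_add_le _ _
      _ ≤ V + M * τ * V := add_le_add (h1 x hx)
          (mul_le_mul (ba x hx) (h0 x hx) (abs_nonneg _) (by positivity))
      _ ≤ 2 * M * τ * V := by nlinarith
  have bw2 : ∀ x ∈ Icc 0 L, |sliceW2 τ ψ b b1 v0 v1 v2 x| ≤ E * (5 * (M * τ) ^ 2 * V) :=
      fun x hx => by
    unfold sliceW2 conj2
    rw [abs_mul]
    refine mul_le_mul (bE x hx) ?_ (abs_nonneg _) hE0.le
    have a1 : |2 * (τ * b x) * v1 x| ≤ 2 * (M * τ) * V := by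
      rw [abs_mul, abs_mul, abs_two]
      exact mul_le_mul (by linarith [ba x hx]) (h1 x hx) (abs_nonneg _) (by positivity)
    have a2 : |((τ * b x) ^ 2 + τ * b1 x) * v0 x| ≤ ((M * τ) ^ 2 + M * τ) * V := by
      rw [abs_mul]
      refine mul_le_mul ((abs_add_le _ _).trans (add_le_add ?_ ?_)) (h0 x hx) (abs_nonneg _)
        (by positivity)
      · rw [abs_pow]; exact pow_le_pow_left₀ (abs_nonneg _) (ba x hx) 2
      · rw [abs_mul, abs_of_nonneg hτ0, mul_comm]
        exact mul_le_mul_of_nonneg_right (hb1 x hx) hτ0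
    calc _ ≤ |v2 x| + |2 * (τ * b x) * v1 x| + |((τ * b x) ^ 2 + τ * b1 x) * v0 x| := by
          exact (abs_add_le _ _).trans (by gcongr; exact abs_add_le _ _)
      _ ≤ V + 2 * (M * τ) * V + ((M * τ) ^ 2 + M * τ) * V := by linarith [h2 x hx]
      _ ≤ 5 * (M * τ) ^ 2 * V := by
          have : M * τ ≤ (M * τ) ^ 2 := by nlinarith
          nlinarith
  have sq : ∀ {y B : ℝ}, |y| ≤ B → y ^ 2 ≤ B ^ 2 := fun h => by
    rw [← sq_abs]; exact pow_le_pow_left₀ (abs_nonneg _) h 2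
  set R := E ^ 2 * (M * τ) ^ 4 * V ^ 2 with hR
  have bden : ∀ x ∈ Icc 0 L, |γ * energyDensity (τ * b x) (sliceW0 τ ψ v0 x)
      (sliceW1 τ ψ b v0 v1 x) (sliceW2 τ ψ b b1 v0 v1 v2 x)| ≤ M * (25 * R) := fun x hx => by
    rw [abs_mul]
    refine mul_le_mul hγ ?_ (abs_nonneg _) hM0
    have s0 := sq (b0 x hx)
    have s1 := sq (bw1 x hx)
    have s2 := sq (bw2 x hx)
    have sa := sq (ba x hx)
    have sa4 : (τ * b x) ^ 4 ≤ (M * τ) ^ 4 := by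
      have := pow_le_pow_left₀ (sq_nonneg _) sa 2
      nlinarith
    have m1 := mul_le_mul sa s1 (sq_nonneg _) (sq_nonneg _)
    have m0 := mul_le_mul sa4 s0 (sq_nonneg _) (by positivity)
    have p1 : 0 ≤ (τ * b x) ^ 2 * sliceW1 τ ψ b v0 v1 x ^ 2 := by positivity
    have p0 : 0 ≤ (τ * b x) ^ 4 * sliceW0 τ ψ v0 x ^ 2 := by positivity
    have p2 := sq_nonneg (sliceW2 τ ψ b b1 v0 v1 v2 x)
    have r1 : (M * τ) ^ 2 * (E * (2 * M * τ * V)) ^ 2 = 4 * R := by rw [hR]; ring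
    have r0 : (M * τ) ^ 4 * (E * V) ^ 2 = R := by rw [hR]; ring
    have r2 : (E * (5 * (M * τ) ^ 2 * V)) ^ 2 = 25 * R := by rw [hR]; ring
    have : 0 ≤ R := by positivity
    unfold energyDensity
    rw [abs_le]
    constructor <;> linarith
  have bI := intervalIntegral.norm_integral_le_of_norm_le_const (a := 0) (b := L)
    (f := fun x => γ * energyDensity (τ * b x) (sliceW0 τ ψ v0 x)
      (sliceW1 τ ψ b v0 v1 x) (sliceW2 τ ψ b b1 v0 v1 v2 x)) (C := M * (25 * R)) (by
      intro x hx
      rw [uIoc_of_le hL.le] at hx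
      exact bden x (Ioc_subset_Icc_self hx))
  rw [norm_eq_abs, sub_zero, abs_of_pos hL] at bI
  have bB : ∀ x ∈ Icc 0 L, |γ * (τ * b x * sliceW1 τ ψ b v0 v1 x ^ 2)| ≤ M * (4 * R) :=
      fun x hx => by
    rw [abs_mul]
    refine mul_le_mul hγ ?_ (abs_nonneg _) hM0
    rw [abs_mul, abs_pow, sq_abs]
    have s1 := sq (bw1 x hx)
    calc _ ≤ M * τ * (E * (2 * M * τ * V)) ^ 2 :=
          mul_le_mul (ba x hx) s1 (sq_nonneg _) (by positivity)
      _ = 1 * (4 * E ^ 2 * (M * τ) ^ 3 * V ^ 2) := by ring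
      _ ≤ (M * τ) * (4 * E ^ 2 * (M * τ) ^ 3 * V ^ 2) := by gcongr
      _ = 4 * R := by rw [hR]; ring
  have tot : |carlemanEnergy γ L τ ψ b b1 v0 v1 v2| ≤ (25 * L + 8) * M * R := by
    have u := bB 0 ⟨le_rfl, hL.le⟩
    have w := bB L ⟨hL.le, le_rfl⟩
    unfold carlemanEnergy
    rw [abs_le] at *
    constructor <;> linarith
  have key := exp_neg_mul_pow_le (c := 2 * c) (by positivity) hτ0 5
  have hE2 : exp (-(2 * c * τ)) = E ^ 2 := by
    rw [hE, ← exp_nat_mul]; congr 1; push_cast; ring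
  rw [hE2] at key
  have f5 : ((Nat.factorial 5 : ℕ) : ℝ) = 120 := by norm_num [Nat.factorial]
  rw [f5] at key
  calc _ ≤ (25 * L + 8) * M * R * τ := mul_le_mul_of_nonneg_right tot hτ0
    _ = (25 * L + 8) * M ^ 5 * V ^ 2 * (E ^ 2 * τ ^ 5) := by rw [hR]; ring
    _ ≤ _ := by gcongr

theorem setIntegral_nonneg_of_hasDerivAt_le {T C : ℝ} {G G' φ : ℝ → ℝ} (hT : 0 < T)
    (hG : ∀ t ∈ Ioo 0 T, HasDerivAt G (G' t) t) (hb : ∀ t ∈ Ioo 0 T, |G t| ≤ C * (t * (T - t)))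
    (hφ : IntegrableOn φ (Ioo 0 T)) (hle : ∀ t ∈ Ioo 0 T, G' t ≤ φ t) :
    0 ≤ ∫ t in Ioo 0 T, φ t := by
  set H := (Ioo 0 T).indicator G with hH
  have bH : ∀ t ∈ Icc 0 T, |H t| ≤ |C| * (t * (T - t)) := by
    intro t ht
    have p : 0 ≤ t * (T - t) := mul_nonneg ht.1 (by linarith [ht.2])
    by_cases h : t ∈ Ioo 0 T
    · rw [hH, indicator_of_mem h]
      exact (hb t h).trans (mul_le_mul_of_nonneg_right (le_abs_self _) p)
    · rw [hH, indicator_of_notMem h, abs_zero]; positivity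
  have hend : ∀ t ∈ Icc 0 T, t ∉ Ioo 0 T → ContinuousWithinAt H (Icc 0 T) t := by
    intro t ht hn
    have hz : H t = 0 := indicator_of_notMem hn _
    have pz : t * (T - t) = 0 := by
      by_contra hne
      rcases eq_or_lt_of_le ht.1 with h | h
      · exact hne (by rw [← h]; ring)
      rcases eq_or_lt_of_le ht.2 with h' | h'
      · exact hne (by rw [h']; ring)
      exact hn ⟨h, h'⟩
    unfold ContinuousWithinAt
    rw [hz]
    refine squeeze_zero_norm' (a := fun t => |C| * (t * (T - t))) ?_ ?_
    · filter_upwards [self_mem_nhdsWithin] with r hr using bH r hr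
    · have : Continuous fun t : ℝ => |C| * (t * (T - t)) := by fun_prop
      have h := this.tendsto t
      simp only [pz, mul_zero] at h
      exact h.mono_left nhdsWithin_le_nhds
  have dH : ∀ t ∈ Ioo 0 T, HasDerivAt H (G' t) t := by
    intro t ht
    refine (hG t ht).congr_of_eventuallyEq ?_
    filter_upwards [isOpen_Ioo.mem_nhds ht] with r hr using indicator_of_mem hr _
  have cH : ContinuousOn H (Icc 0 T) := by
    intro t ht
    by_cases h : t ∈ Ioo 0 T
    · exact (dH t h).continuousAt.continuousWithinAt
    · exact hend t ht h
  have := intervalIntegral.sub_le_integral_of_hasDeriv_right_of_le hT.le cH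
    (fun t ht => (dH t ht).hasDerivWithinAt) ((integrableOn_Icc_iff_integrableOn_Ioo (by simp) (by simp)).2 hφ)
    hle
  rw [intervalIntegral.integral_of_le hT.le, integral_Ioc_eq_integral_Ioo] at this
  have h0 : H 0 = 0 := indicator_of_notMem (by simp) _
  have h1 : H T = 0 := indicator_of_notMem (by simp) _
  rw [h0, h1] at this
  linarith

theorem integrableOn_setIntegral_of_bounded {T L B : ℝ} {S : Set ℝ} {f : ℝ → ℝ → ℝ}
    (hSL : S ⊆ Ioo 0 L) (hf : Measurable (Function.uncurry f)) (hS : MeasurableSet S)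
    (hB : ∀ t ∈ Ioo 0 T, ∀ x ∈ Ioo 0 L, |f t x| ≤ B) :
    IntegrableOn (fun t => ∫ x in S, f t x) (Ioo 0 T) := by
  have fin : volume S < ⊤ := (measure_mono hSL).trans_lt measure_Ioo_lt_top
  have : IntegrableOn (Function.uncurry f) (Ioo 0 T ×ˢ S) (volume.prod volume) := by
    refine IntegrableOn.of_bound (C := B) ?_ hf.aestronglyMeasurable ?_
    · rw [Measure.prod_prod]; exact ENNReal.mul_lt_top measure_Ioo_lt_top fin
    · filter_upwards [ae_restrict_mem (measurableSet_Ioo.prod hS)] with p hp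
      exact hB _ hp.1 _ (hSL hp.2)
  rw [IntegrableOn, ← Measure.prod_restrict] at this
  exact this.integral_prod_left

theorem deriv_time_eq_zero_of_vanishing {f : ℝ → ℝ} {T f' t : ℝ} (ht : t ∈ Ioo 0 T)
    (hf : ∀ r ∈ Ioo 0 T, f r = 0) (hd : HasDerivAt f f' t) : f' = 0 :=
  hd.unique ((hasDerivAt_const t (0 : ℝ)).congr_of_eventuallyEq (by
    filter_upwards [isOpen_Ioo.mem_nhds ht] with r hr using hf r hr))

theorem hasDerivAt_timeWeight {lam T t : ℝ} (ht : t ∈ Ioo 0 T) :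
    HasDerivAt (fun r => lam / (r * (T - r)))
      (-(T - 2 * t) / lam * (lam / (t * (T - t))) ^ 2) t := by
  have h1 : t ≠ 0 := ht.1.ne'
  have h2 : T - t ≠ 0 := (sub_pos.2 ht.2).ne'
  have hd : HasDerivAt (fun r => r * (T - r)) (1 * (T - t) + t * (-1)) t :=
    (hasDerivAt_id t).mul ((hasDerivAt_id t).const_sub T)
  refine ((hasDerivAt_const t lam).div hd (mul_ne_zero h1 h2)).congr_deriv ?_
  field_simp
  ring

theorem exists_bound_on_rectangle {f : ℝ → ℝ → ℝ} (hf : Continuous (Function.uncurry f))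
    (T L : ℝ) : ∃ B, ∀ t ∈ Icc 0 T, ∀ x ∈ Icc 0 L, |f t x| ≤ B := by
  obtain ⟨B, hB⟩ := (isCompact_Icc.prod isCompact_Icc).exists_bound_of_continuousOn
    (hf.continuousOn (s := Icc 0 T ×ˢ Icc 0 L))
  exact ⟨B, fun t ht x hx => hB (t, x) ⟨ht, hx⟩⟩

theorem carleman_spaceTime {γ L T M δ c k₁ k₂ lam : ℝ} {ω₀ : Set ℝ} {ψ b b1 b2 b3 : ℝ → ℝ}
    {v0 v1 v2 v3 v4 q0 q1 q2 J : ℝ → ℝ → ℝ} (hL : 0 < L) (hψ : WeightJet ψ b b1 b2 b3)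
    (hW : ∀ x ∈ Icc 0 L, ∀ κ, |κ| ≤ T → WeightBound M γ κ (ψ x) (b x) (b1 x) (b2 x) (b3 x))
    (hT : 0 < T) (hδ : 0 < δ) (hδ1 : δ ≤ 1) (hlam1 : 1 ≤ lam)
    (hlam : T ^ 2 * (1 + 1000 * M ^ 6 / δ ^ 4) ≤ lam)
    (hlam' : T ^ 2 * (1 + 61 * M ^ 4 / (48 * δ ^ 5)) ≤ lam)
    (hω : IsOpen ω₀) (hωL : ω₀ ⊆ Ioo 0 L)
    (hgood : ∀ x ∈ Icc 0 L \ ω₀, δ ≤ b1 x ∧ δ ≤ b x ^ 2) (hb0 : δ ≤ b 0) (hbL : b L ≤ -δ)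
    (hc : 0 < c) (hψc : ∀ x ∈ Icc 0 L, ψ x ≤ -c)
    (hv : SpaceTimeJet v0 v1 v2 v3 v4 q0 q1 q2)
    (bd : ∀ x, x = 0 ∨ x = L → (∀ t ∈ Ioo 0 T, v0 t x = 0) ∧
      ((∀ t ∈ Ioo 0 T, v1 t x = 0) ∨ (∀ t ∈ Ioo 0 T, v2 t x = 0)))
    (hJm : Measurable (Function.uncurry J)) (hJc : ∀ t ∈ Ioo 0 T, Continuous (J t))
    (hJ0 : ∀ t ∈ Ioo 0 T, ∀ x, 0 ≤ J t x) (hk₁ : 0 < k₁)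
    (hJ1 : ∀ t ∈ Ioo 0 T, ∀ x ∈ Icc 0 L, k₁ * J t x ≤ exp (lam / (t * (T - t)) * ψ x) ^ 2 *
      (lam / (t * (T - t)) * weightedSq (lam / (t * (T - t))) (v0 t x) (v1 t x) (v2 t x) (v3 t x)))
    (hJ2 : ∀ t ∈ Ioo 0 T, ∀ x ∈ Icc 0 L, exp (lam / (t * (T - t)) * ψ x) ^ 2 *
      (lam / (t * (T - t)) * weightedSq (lam / (t * (T - t))) (v0 t x) (v1 t x) (v2 t x) (v3 t x))
        ≤ k₂ * J t x) :
    δ ^ 4 / (1600 * M ^ 6) * k₁ * (∫ t in Ioo 0 T, ∫ x in Ioo 0 L, J t x)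
      ≤ 1 / 2 * (∫ t in Ioo 0 T, ∫ x in Ioo 0 L,
          exp (lam / (t * (T - t)) * ψ x) ^ 2 * (γ * q0 t x + v4 t x) ^ 2)
        + (δ ^ 4 / (1600 * M ^ 6) + 1060 * M ^ 7 * (1600 * M ^ 6)) * k₂
          * (∫ t in Ioo 0 T, ∫ x in ω₀, J t x) := by
  have hlam0 : 0 < lam := by linarith
  have W0 := hW 0 ⟨le_rfl, hL.le⟩ 0 (by rw [abs_zero]; exact hT.le)
  have hM := W0.one_le
  have hM0 : 0 ≤ M := by linarith
  have hp : ∀ t ∈ Ioo 0 T, 0 < t * (T - t) := fun t ht => mul_pos ht.1 (sub_pos.2 ht.2)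
  have hτ : ∀ t ∈ Ioo 0 T, ∀ y, 0 ≤ y → T ^ 2 * y ≤ lam → y ≤ lam / (t * (T - t)) :=
      fun t ht y hy h => by
    rw [le_div_iff₀ (hp t ht)]
    have : t * (T - t) ≤ T ^ 2 := by nlinarith [ht.1, ht.2]
    nlinarith
  have r1 : 0 ≤ 1000 * M ^ 6 / δ ^ 4 := by positivity
  have r2 : 0 ≤ 61 * M ^ 4 / (48 * δ ^ 5) := by positivity
  have hτ1 : ∀ t ∈ Ioo 0 T, 1 ≤ lam / (t * (T - t)) := fun t ht =>
    le_trans (by linarith) (hτ t ht _ (by linarith) hlam)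
  obtain ⟨B0, hB0⟩ := exists_bound_on_rectangle hv.c0 T L
  obtain ⟨B1, hB1⟩ := exists_bound_on_rectangle hv.c1 T L
  obtain ⟨B2, hB2⟩ := exists_bound_on_rectangle hv.c2 T L
  obtain ⟨B3, hB3⟩ := exists_bound_on_rectangle hv.c3 T L
  obtain ⟨B4, hB4⟩ := exists_bound_on_rectangle hv.c4 T L
  obtain ⟨B5, hB5⟩ := exists_bound_on_rectangle hv.cq0 T L
  have cs : ∀ {f : ℝ → ℝ → ℝ}, Continuous (Function.uncurry f) → ∀ t, Continuous (f t) :=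
    fun h t => h.comp (by fun_prop : Continuous fun x => (t, x))
  have memT : ∀ {t}, t ∈ Ioo 0 T → t ∈ Icc 0 T := fun h => Ioo_subset_Icc_self h
  set V := |B0| + |B1| + |B2| + |B3| with hV
  have b0 : ∀ t ∈ Ioo 0 T, ∀ x ∈ Icc 0 L, |v0 t x| ≤ V := fun t ht x hx =>
    (hB0 t (memT ht) x hx).trans
      (by linarith [le_abs_self B0, abs_nonneg B1, abs_nonneg B2, abs_nonneg B3])
  have b1' : ∀ t ∈ Ioo 0 T, ∀ x ∈ Icc 0 L, |v1 t x| ≤ V := fun t ht x hx =>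
    (hB1 t (memT ht) x hx).trans
      (by linarith [le_abs_self B1, abs_nonneg B0, abs_nonneg B2, abs_nonneg B3])
  have b2' : ∀ t ∈ Ioo 0 T, ∀ x ∈ Icc 0 L, |v2 t x| ≤ V := fun t ht x hx =>
    (hB2 t (memT ht) x hx).trans
      (by linarith [le_abs_self B2, abs_nonneg B1, abs_nonneg B0, abs_nonneg B3])
  have b3' : ∀ t ∈ Ioo 0 T, ∀ x ∈ Icc 0 L, |v3 t x| ≤ V := fun t ht x hx =>
    (hB3 t (memT ht) x hx).trans
      (by linarith [le_abs_self B3, abs_nonneg B1, abs_nonneg B2, abs_nonneg B0])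
  have sqb : ∀ {y B : ℝ}, |y| ≤ B → y ^ 2 ≤ B ^ 2 := fun h => by
    rw [← sq_abs]; exact pow_le_pow_left₀ (abs_nonneg _) h 2
  have bJ : ∀ t ∈ Ioo 0 T, ∀ x ∈ Ioo 0 L,
      |J t x| ≤ (4 * V ^ 2 * ((Nat.factorial 7 : ℕ) / (2 * c) ^ 7)) / k₁ := by
    intro t ht x hx'
    have hx := Ioo_subset_Icc_self hx'
    rw [abs_of_nonneg (hJ0 t ht x), le_div_iff₀ hk₁, mul_comm]
    refine (hJ1 t ht x hx).trans ?_
    set τ := lam / (t * (T - t))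
    have t1 : 1 ≤ τ := hτ1 t ht
    have key := exp_neg_mul_pow_le (c := 2 * c) (by positivity) (by linarith : 0 ≤ τ) 7
    have hE : exp (τ * ψ x) ^ 2 ≤ exp (-(2 * c * τ)) := by
      rw [← exp_nat_mul]
      exact exp_le_exp.2 (by push_cast; nlinarith [hψc x hx])
    have hN : weightedSq τ (v0 t x) (v1 t x) (v2 t x) (v3 t x) ≤ 4 * V ^ 2 * τ ^ 6 := by
      have s0 := sqb (b0 t ht x hx)
      have s1 := sqb (b1' t ht x hx)
      have s2 := sqb (b2' t ht x hx)
      have s3 := sqb (b3' t ht x hx)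
      have p2 : τ ^ 2 ≤ τ ^ 6 := pow_le_pow_right₀ t1 (by norm_num)
      have p4 : τ ^ 4 ≤ τ ^ 6 := pow_le_pow_right₀ t1 (by norm_num)
      have p0 : 1 ≤ τ ^ 6 := one_le_pow₀ t1
      have m3 : v3 t x ^ 2 ≤ τ ^ 6 * V ^ 2 :=
        s3.trans (le_mul_of_one_le_left (sq_nonneg _) p0)
      have m2 := mul_le_mul p2 s2 (sq_nonneg _) (by positivity)
      have m1 := mul_le_mul p4 s1 (sq_nonneg _) (by positivity)
      have m0 := mul_le_mul_of_nonneg_left s0 (by positivity : 0 ≤ τ ^ 6)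
      unfold weightedSq
      linarith
    calc exp (τ * ψ x) ^ 2 * (τ * weightedSq τ (v0 t x) (v1 t x) (v2 t x) (v3 t x))
        ≤ exp (-(2 * c * τ)) * (τ * (4 * V ^ 2 * τ ^ 6)) := by
          refine mul_le_mul hE ?_ ?_ (exp_pos _).le
          · exact mul_le_mul_of_nonneg_left hN (by linarith)
          · exact mul_nonneg (by linarith) (weightedSq_nonneg _ _ _ _ _)
      _ = 4 * V ^ 2 * (exp (-(2 * c * τ)) * τ ^ 7) := by ring
      _ ≤ _ := by gcongr
  have bF : ∀ t ∈ Ioo 0 T, ∀ x ∈ Ioo 0 L,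
      |exp (lam / (t * (T - t)) * ψ x) ^ 2 * (γ * q0 t x + v4 t x) ^ 2|
        ≤ 1 * (M * B5 + B4) ^ 2 := by
    intro t ht x hx'
    have hx := Ioo_subset_Icc_self hx'
    rw [abs_of_nonneg (by positivity)]
    refine mul_le_mul ?_ (sqb ?_) (sq_nonneg _) zero_le_one
    · refine pow_le_one₀ (exp_pos _).le (exp_le_one_iff.2 ?_)
      exact mul_nonpos_of_nonneg_of_nonpos (by linarith [hτ1 t ht]) (by linarith [hψc x hx])
    · refine (abs_add_le _ _).trans (add_le_add ?_ (hB4 t (memT ht) x hx))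
      rw [abs_mul]
      exact mul_le_mul W0.hγ (hB5 t (memT ht) x hx) (abs_nonneg _) hM0
  have cψ := hψ.continuous_zero
  have mF : Measurable (Function.uncurry fun t x =>
      exp (lam / (t * (T - t)) * ψ x) ^ 2 * (γ * q0 t x + v4 t x) ^ 2) := by
    have m1 : Measurable fun p : ℝ × ℝ => q0 p.1 p.2 := hv.cq0.measurable
    have m2 : Measurable fun p : ℝ × ℝ => v4 p.1 p.2 := hv.c4.measurable
    have m3 : Measurable fun p : ℝ × ℝ => ψ p.2 := (cψ.comp continuous_snd).measurable
    unfold Function.uncurry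
    fun_prop
  have iJ := integrableOn_setIntegral_of_bounded (T := T) Subset.rfl hJm measurableSet_Ioo bJ
  have iω := integrableOn_setIntegral_of_bounded (T := T) hωL hJm hω.measurableSet bJ
  have iF := integrableOn_setIntegral_of_bounded (T := T) Subset.rfl mF measurableSet_Ioo bF
  set D := (25 * L + 8) * M ^ 5 * V ^ 2 * (120 / (2 * c) ^ 5) with hD
  have main := setIntegral_nonneg_of_hasDerivAt_le (C := D / lam) hT
    (G := fun t => carlemanEnergy γ L (lam / (t * (T - t))) ψ b b1 (v0 t) (v1 t) (v2 t))
    (fun t ht => hasDerivAt_carlemanEnergy (τ := fun t => lam / (t * (T - t)))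
      (κ := fun t => -(T - 2 * t) / lam) hψ hv isOpen_Ioo ht
      (fun r hr => hasDerivAt_timeWeight hr) (by fun_prop))
    (fun t ht => by
      have := abs_carlemanEnergy_le hL hM W0.hγ hc (hτ1 t ht) hψc
        (fun x hx => (hW x hx 0 (by rw [abs_zero]; exact hT.le)).hb)
        (fun x hx => (hW x hx 0 (by rw [abs_zero]; exact hT.le)).hb1)
        (b0 t ht) (b1' t ht) (b2' t ht)
      rw [← hD, ← le_div_iff₀ (by linarith [hτ1 t ht])] at this
      refine this.trans (le_of_eq ?_)
      have := (hp t ht).ne'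
      field_simp)
    (((iF.const_mul (1 / 2)).sub (iJ.const_mul (δ ^ 4 / (1600 * M ^ 6) * k₁))).add
      (iω.const_mul ((δ ^ 4 / (1600 * M ^ 6) + 1060 * M ^ 7 * (1600 * M ^ 6)) * k₂)))
    (fun t ht => by
      refine carleman_slice hL hψ (fun x hx => hW x hx _ ?_) hδ hδ1
        (hτ t ht _ (by linarith) hlam) (hτ t ht _ (by linarith) hlam') hω hωL hgood hb0 hbL
        (hv.d0 t) (hv.d1 t) (hv.d2 t) (hv.d3 t) (cs hv.c4 t) (hv.dq0 t) (hv.dq1 t)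
        (cs hv.cq2 t) (fun x hx => ?_) (hJc t ht) (hJ1 t ht) (hJ2 t ht)
      · rw [abs_div, abs_neg, abs_of_pos hlam0, div_le_iff₀ hlam0]
        refine (abs_le.2 ⟨?_, ?_⟩ : |T - 2 * t| ≤ T).trans (le_mul_of_one_le_right hT.le hlam1)
        · linarith [ht.2]
        · linarith [ht.1]
      · obtain ⟨u1, u2⟩ := bd x hx
        refine ⟨u1 t ht, deriv_time_eq_zero_of_vanishing ht u1 (hv.e0 t x), ?_⟩
        exact u2.imp
          (fun u => ⟨u t ht, deriv_time_eq_zero_of_vanishing ht u (hv.e1 t x)⟩) (fun u => u t ht))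
  rw [integral_add' ((iF.const_mul _).sub (iJ.const_mul _)) (iω.const_mul _),
    integral_sub' (iF.const_mul _) (iJ.const_mul _), integral_const_mul, integral_const_mul,
    integral_const_mul] at main
  linarith

theorem deriv_nonneg_of_nonneg_right {f : ℝ → ℝ} {a L f' : ℝ} (hL : a < L)
    (hd : HasDerivAt f f' a) (ha : f a = 0) (hf : ∀ x ∈ Ioo a L, 0 ≤ f x) : 0 ≤ f' := by
  refine ge_of_tendsto hd.tendsto_slope_zero_right ?_
  filter_upwards [Ioo_mem_nhdsGT (sub_pos.2 hL)] with t ht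
  have := hf (a + t) ⟨by linarith [ht.1], by linarith [ht.2]⟩
  rw [ha, sub_zero, smul_eq_mul]
  exact mul_nonneg (inv_nonneg.2 ht.1.le) this

theorem deriv_nonpos_of_nonneg_left {f : ℝ → ℝ} {a L f' : ℝ} (hL : a < L)
    (hd : HasDerivAt f f' L) (hfL : f L = 0) (hf : ∀ x ∈ Ioo a L, 0 ≤ f x) : f' ≤ 0 := by
  refine le_of_tendsto hd.tendsto_slope_zero_left ?_
  filter_upwards [Ioo_mem_nhdsLT (sub_neg.2 hL)] with t ht
  have := hf (L + t) ⟨by linarith [ht.1], by linarith [ht.2]⟩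
  rw [hfL, sub_zero, smul_eq_mul]
  exact mul_nonpos_of_nonpos_of_nonneg (inv_nonpos.2 ht.2.le) this

/-- The integrand of the weighted norm, in terms of the space derivatives. -/
noncomputable def carlemanDensity (lam s T K : ℝ) (φh : ℝ → ℝ) (v0 v1 v2 v3 : ℝ → ℝ → ℝ)
    (t x : ℝ) : ℝ :=
  exp (2 * lam * wrho s T K φh t x) * lam * s ^ 2 * wphi s T φh t x *
    ((v3 t x) ^ 2
      + lam ^ 2 * s ^ 2 * (wphi s T φh t x) ^ 2 * (v2 t x) ^ 2
      + lam ^ 4 * s ^ 4 * (wphi s T φh t x) ^ 4 * (v1 t x) ^ 2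
      + lam ^ 6 * s ^ 6 * (wphi s T φh t x) ^ 6 * (v0 t x) ^ 2)

theorem exp_wrho (lam s T K : ℝ) (φh : ℝ → ℝ) (t x : ℝ) :
    exp (2 * lam * wrho s T K φh t x)
      = exp (lam / (t * (T - t)) * (exp (s * φh x) - exp (2 * s * K))) ^ 2 := by
  rw [← exp_nat_mul]
  congr 1
  unfold wrho
  push_cast
  ring

theorem carlemanDensity_eq (lam s T K : ℝ) (φh : ℝ → ℝ) (v0 v1 v2 v3 : ℝ → ℝ → ℝ) (t x : ℝ) :
    carlemanDensity lam s T K φh v0 v1 v2 v3 t x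
      = exp (lam / (t * (T - t)) * (exp (s * φh x) - exp (2 * s * K))) ^ 2 *
        (lam / (t * (T - t)) * (s ^ 2 * exp (s * φh x) * v3 t x ^ 2
          + s ^ 4 * exp (s * φh x) ^ 3 * ((lam / (t * (T - t))) ^ 2 * v2 t x ^ 2)
          + s ^ 6 * exp (s * φh x) ^ 5 * ((lam / (t * (T - t))) ^ 4 * v1 t x ^ 2)
          + s ^ 8 * exp (s * φh x) ^ 7 * ((lam / (t * (T - t))) ^ 6 * v0 t x ^ 2))) := by
  unfold carlemanDensity
  rw [exp_wrho]
  unfold wphi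
  ring

theorem carlemanDensity_nonneg {lam s T t : ℝ} (K : ℝ) (φh : ℝ → ℝ) (v0 v1 v2 v3 : ℝ → ℝ → ℝ)
    (x : ℝ) (hlam : 0 ≤ lam) (ht : t ∈ Ioo 0 T) :
    0 ≤ carlemanDensity lam s T K φh v0 v1 v2 v3 t x := by
  have : 0 < t * (T - t) := mul_pos ht.1 (sub_pos.2 ht.2)
  unfold carlemanDensity wphi
  positivity

theorem weightedSq_le_carlemanDensity {lam s T t x : ℝ} (K : ℝ) {φh : ℝ → ℝ}
    (v0 v1 v2 v3 : ℝ → ℝ → ℝ) (hlam : 0 ≤ lam) (ht : t ∈ Ioo 0 T) (hs : 1 ≤ s)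
    (hφ : 0 ≤ φh x) :
    exp (lam / (t * (T - t)) * (exp (s * φh x) - exp (2 * s * K))) ^ 2 *
      (lam / (t * (T - t)) *
        weightedSq (lam / (t * (T - t))) (v0 t x) (v1 t x) (v2 t x) (v3 t x))
      ≤ carlemanDensity lam s T K φh v0 v1 v2 v3 t x := by
  have hp : 0 < t * (T - t) := mul_pos ht.1 (sub_pos.2 ht.2)
  have hg : 1 ≤ exp (s * φh x) := one_le_exp (by positivity)
  have k : ∀ m n : ℕ, 1 ≤ s ^ m * exp (s * φh x) ^ n := fun m n =>
    one_le_mul_of_one_le_of_one_le (one_le_pow₀ hs) (one_le_pow₀ hg)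
  have k1 : 1 ≤ s ^ 2 * exp (s * φh x) := by simpa using k 2 1
  rw [carlemanDensity_eq]
  refine mul_le_mul_of_nonneg_left (mul_le_mul_of_nonneg_left ?_ (by positivity)) (by positivity)
  unfold weightedSq
  refine add_le_add (add_le_add (add_le_add ?_ ?_) ?_) ?_
  · exact le_mul_of_one_le_left (by positivity) k1
  · exact le_mul_of_one_le_left (by positivity) (k 4 3)
  · exact le_mul_of_one_le_left (by positivity) (k 6 5)
  · exact le_mul_of_one_le_left (by positivity) (k 8 7)

theorem carlemanDensity_le_weightedSq {lam s T t x Γ : ℝ} (K : ℝ) {φh : ℝ → ℝ}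
    (v0 v1 v2 v3 : ℝ → ℝ → ℝ) (hlam : 0 ≤ lam) (ht : t ∈ Ioo 0 T) (hs : 1 ≤ s)
    (hφ : 0 ≤ φh x) (hΓ : exp (s * φh x) ≤ Γ) :
    carlemanDensity lam s T K φh v0 v1 v2 v3 t x ≤ s ^ 8 * Γ ^ 7 *
      (exp (lam / (t * (T - t)) * (exp (s * φh x) - exp (2 * s * K))) ^ 2 *
        (lam / (t * (T - t)) *
          weightedSq (lam / (t * (T - t))) (v0 t x) (v1 t x) (v2 t x) (v3 t x))) := by
  have hp : 0 < t * (T - t) := mul_pos ht.1 (sub_pos.2 ht.2)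
  have hg : 1 ≤ exp (s * φh x) := one_le_exp (by positivity)
  have k : ∀ m n : ℕ, m ≤ 8 → n ≤ 7 → s ^ m * exp (s * φh x) ^ n ≤ s ^ 8 * Γ ^ 7 :=
    fun m n hm hn => mul_le_mul (pow_le_pow_right₀ hs hm)
      ((pow_le_pow_right₀ hg hn).trans (pow_le_pow_left₀ (exp_pos _).le hΓ 7))
      (by positivity) (by positivity)
  have k1 : s ^ 2 * exp (s * φh x) ≤ s ^ 8 * Γ ^ 7 := by
    simpa using k 2 1 (by norm_num) (by norm_num)
  rw [carlemanDensity_eq]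
  have : ∀ E A W N : ℝ, N * (E * (A * W)) = E * (A * (N * W)) := fun _ _ _ _ => by ring
  rw [this]
  refine mul_le_mul_of_nonneg_left (mul_le_mul_of_nonneg_left ?_ (by positivity)) (by positivity)
  unfold weightedSq
  rw [mul_add, mul_add, mul_add]
  refine add_le_add (add_le_add (add_le_add ?_ ?_) ?_) ?_
  · exact mul_le_mul_of_nonneg_right k1 (by positivity)
  · exact mul_le_mul_of_nonneg_right (k 4 3 (by norm_num) (by norm_num)) (by positivity)
  · exact mul_le_mul_of_nonneg_right (k 6 5 (by norm_num) (by norm_num)) (by positivity)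
  · exact mul_le_mul_of_nonneg_right (k 8 7 (by norm_num) (by norm_num)) (by positivity)

theorem exists_weight_lower_bound {L : ℝ} {ω₀ : Set ℝ} {φh : ℝ → ℝ} (hL : 0 < L)
    (hω₀ : IsOpen ω₀) (hωL : ω₀ ⊆ Ioo 0 L) (hφ : ContDiff ℝ 4 φh)
    (hφpos : ∀ x ∈ Ioo 0 L, 0 < φh x) (hφ0 : φh 0 = 0) (hφL : φh L = 0)
    (hφ' : ∀ x ∈ Icc 0 L \ ω₀, deriv φh x ≠ 0) :
    ∃ s₀ ≥ (1:ℝ), ∀ s ≥ s₀, ∀ D, ∃ δ > (0:ℝ), δ ≤ 1 ∧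
      (∀ x ∈ Icc 0 L \ ω₀, δ ≤ deriv (deriv fun y => exp (s * φh y) - D) x ∧
        δ ≤ deriv (fun y => exp (s * φh y) - D) x ^ 2) ∧
      δ ≤ deriv (fun y => exp (s * φh y) - D) 0 ∧
      deriv (fun y => exp (s * φh y) - D) L ≤ -δ := by
  have hφ1 : ContDiff ℝ 3 (deriv φh) :=
    (contDiff_succ_iff_deriv (n := 3).1 (by norm_num; exact hφ)).2.2
  have dφ : ∀ x, HasDerivAt φh (deriv φh x) x := fun x =>
    (hφ.differentiable (by norm_num) x).hasDerivAt
  have dφ' : ∀ x, HasDerivAt (deriv φh) (deriv (deriv φh) x) x := fun x =>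
    (hφ1.differentiable (by norm_num) x).hasDerivAt
  have cφ1 : Continuous (deriv φh) := hφ1.continuous
  have cφ2 : Continuous (deriv (deriv φh)) := hφ1.continuous_deriv (by norm_num)
  have m0 : (0:ℝ) ∈ Icc 0 L \ ω₀ := ⟨⟨le_rfl, hL.le⟩, fun h => lt_irrefl _ (hωL h).1⟩
  have mL : L ∈ Icc 0 L \ ω₀ := ⟨⟨hL.le, le_rfl⟩, fun h => lt_irrefl _ (hωL h).2⟩
  have φnn : ∀ x ∈ Icc 0 L, 0 ≤ φh x := fun x hx => by
    rcases eq_or_lt_of_le hx.1 with h | h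
    · rw [← h, hφ0]
    rcases eq_or_lt_of_le hx.2 with h' | h'
    · rw [h', hφL]
    exact (hφpos x ⟨h, h'⟩).le
  have d0 : 0 < deriv φh 0 := lt_of_le_of_ne
    (deriv_nonneg_of_nonneg_right hL (dφ 0) hφ0 fun x hx => (hφpos x hx).le) (hφ' 0 m0).symm
  have dL : deriv φh L < 0 := lt_of_le_of_ne
    (deriv_nonpos_of_nonneg_left hL (dφ L) hφL fun x hx => (hφpos x hx).le) (hφ' L mL)
  have cK : IsCompact (Icc 0 L \ ω₀) := isCompact_Icc.diff hω₀
  obtain ⟨x₀, hx₀, hmin⟩ := cK.exists_isMinOn ⟨0, m0⟩ (cφ1.pow 2).continuousOn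
  set m := deriv φh x₀ ^ 2 with hm
  have hm0 : 0 < m := by have := hφ' x₀ hx₀; positivity
  have hmle : ∀ x ∈ Icc 0 L \ ω₀, m ≤ deriv φh x ^ 2 := fun x hx => hmin hx
  obtain ⟨N, hN⟩ := isCompact_Icc.exists_bound_of_continuousOn (cφ2.continuousOn (s := Icc 0 L))
  have hN0 : 0 ≤ N := (norm_nonneg _).trans (hN 0 m0.1)
  refine ⟨1 + (N + 1) / m, by simp only [ge_iff_le, le_add_iff_nonneg_right]; positivity, ?_⟩
  intro s hs D
  have q0 : 0 ≤ (N + 1) / m := by positivity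
  have hs1 : 1 ≤ s := by linarith
  have hsm : N + 1 ≤ s * m := by
    rw [← div_le_iff₀ hm0]; linarith
  have e1 : ∀ x, HasDerivAt (fun y => exp (s * φh y) - D) (exp (s * φh x) * (s * deriv φh x)) x :=
    fun x => (((dφ x).const_mul s).exp).sub_const D
  have e1' : deriv (fun y => exp (s * φh y) - D) = fun x => exp (s * φh x) * (s * deriv φh x) :=
    funext fun x => (e1 x).deriv
  have e2 : ∀ x, deriv (deriv fun y => exp (s * φh y) - D) x
      = s * exp (s * φh x) * (s * deriv φh x ^ 2 + deriv (deriv φh) x) := fun x => by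
    rw [e1']
    refine ((((dφ x).const_mul s).exp).mul ((dφ' x).const_mul s)).deriv.trans ?_
    ring
  set δ := min 1 (min m (min (deriv φh 0) (-deriv φh L))) with hδ
  have l1 : δ ≤ 1 := min_le_left _ _
  have l2 : δ ≤ m := (min_le_right _ _).trans (min_le_left _ _)
  have l3 : δ ≤ deriv φh 0 :=
    (min_le_right _ _).trans ((min_le_right _ _).trans (min_le_left _ _))
  have l4 : δ ≤ -deriv φh L :=
    (min_le_right _ _).trans ((min_le_right _ _).trans (min_le_right _ _))
  refine ⟨δ, lt_min one_pos (lt_min hm0 (lt_min d0 (neg_pos.2 dL))), l1, ?_, ?_, ?_⟩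
  · intro x hx
    have hg : 1 ≤ exp (s * φh x) := one_le_exp (mul_nonneg (by linarith) (φnn x hx.1))
    have hsg : 1 ≤ s * exp (s * φh x) := one_le_mul_of_one_le_of_one_le hs1 hg
    have hd := hmle x hx
    constructor
    · rw [e2]
      have h1 : s * m ≤ s * deriv φh x ^ 2 := mul_le_mul_of_nonneg_left hd (by linarith)
      have h2 := (abs_le.1 (hN x hx.1)).1
      have h3 : 1 ≤ s * deriv φh x ^ 2 + deriv (deriv φh) x := by linarith
      exact l1.trans (one_le_mul_of_one_le_of_one_le hsg h3)
    · rw [e1']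
      have : (exp (s * φh x) * (s * deriv φh x)) ^ 2
          = (s * exp (s * φh x)) ^ 2 * deriv φh x ^ 2 := by ring
      simp only [this]
      exact (l2.trans hd).trans (le_mul_of_one_le_left (sq_nonneg _) (one_le_pow₀ hsg))
  · rw [e1']
    simp only [hφ0, mul_zero, exp_zero, one_mul]
    exact l3.trans (le_mul_of_one_le_left d0.le hs1)
  · rw [e1']
    simp only [hφL, mul_zero, exp_zero, one_mul]
    nlinarith

/-- Carleman estimate with observation on `ω₀` for `γ∂_t + ∂_x⁴`, `θ = e^{λρ}`. -/
theorem carleman_intermediate_omega0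
    (L T γ : ℝ) (hL : 0 < L) (hT : 0 < T)
    (ω₀ ω : Set ℝ) (hω₀ : IsOpen ω₀) (hω : IsOpen ω) (hne : ω₀.Nonempty)
    (hsub : closure ω₀ ⊆ ω) (hωΩ : ω ⊆ Ioo 0 L)
    (φh : ℝ → ℝ) (hφ : ContDiff ℝ 4 φh) (hφpos : ∀ x ∈ Ioo (0:ℝ) L, 0 < φh x)
    (hφ0 : φh 0 = 0) (hφL : φh L = 0)
    (hφ' : ∀ x ∈ Icc (0:ℝ) L \ ω₀, deriv φh x ≠ 0)
    (K : ℝ) (hK : K = sSup ((fun x => |φh x|) '' Icc (0:ℝ) L)) :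
    ∃ s₀ > (0:ℝ), ∀ s ≥ s₀, ∃ lam₀ > (0:ℝ), ∃ C > (0:ℝ),
      ∀ v : ℝ → ℝ → ℝ, ContDiff ℝ 4 (Function.uncurry v) →
      IntegrableOn (fun p : ℝ × ℝ =>
        (γ * deriv (fun τ => v τ p.2) p.1 + iteratedDeriv 4 (v p.1) p.2) ^ 2)
        (Ioo 0 T ×ˢ Ioo 0 L) →
      ((∀ t ∈ Ioo (0:ℝ) T, v t 0 = 0 ∧ v t L = 0 ∧ deriv (v t) 0 = 0 ∧ deriv (v t) L = 0) ∨
       (∀ t ∈ Ioo (0:ℝ) T, v t 0 = 0 ∧ v t L = 0 ∧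
          iteratedDeriv 2 (v t) 0 = 0 ∧ iteratedDeriv 2 (v t) L = 0)) →
      ∀ lam ≥ lam₀,
      (∫ t in Ioo (0:ℝ) T, ∫ x in Ioo (0:ℝ) L,
          exp (2 * lam * wrho s T K φh t x) * lam * s ^ 2 * wphi s T φh t x *
            ((iteratedDeriv 3 (v t) x) ^ 2
              + lam ^ 2 * s ^ 2 * (wphi s T φh t x) ^ 2 * (iteratedDeriv 2 (v t) x) ^ 2
              + lam ^ 4 * s ^ 4 * (wphi s T φh t x) ^ 4 * (deriv (v t) x) ^ 2
              + lam ^ 6 * s ^ 6 * (wphi s T φh t x) ^ 6 * (v t x) ^ 2))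
      ≤ C * (∫ t in Ioo (0:ℝ) T, ∫ x in ω₀,
            exp (2 * lam * wrho s T K φh t x) * lam * s ^ 2 * wphi s T φh t x *
              ((iteratedDeriv 3 (v t) x) ^ 2
                + lam ^ 2 * s ^ 2 * (wphi s T φh t x) ^ 2 * (iteratedDeriv 2 (v t) x) ^ 2
                + lam ^ 4 * s ^ 4 * (wphi s T φh t x) ^ 4 * (deriv (v t) x) ^ 2
                + lam ^ 6 * s ^ 6 * (wphi s T φh t x) ^ 6 * (v t x) ^ 2))
        + C * (∫ t in Ioo (0:ℝ) T, ∫ x in Ioo (0:ℝ) L,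
            exp (2 * lam * wrho s T K φh t x) *
              (γ * deriv (fun τ => v τ x) t + iteratedDeriv 4 (v t) x) ^ 2) := by
  have hωL : ω₀ ⊆ Ioo 0 L := (subset_closure.trans hsub).trans hωΩ
  obtain ⟨s₀, hs₀, hweight⟩ :=
    exists_weight_lower_bound hL hω₀ hωL hφ hφpos hφ0 hφL hφ'
  refine ⟨s₀, by linarith, fun s hs => ?_⟩
  have hs1 : 1 ≤ s := hs₀.trans hs
  obtain ⟨δ, hδ, hδ1, hgood, hb0, hbL⟩ := hweight s hs (exp (2 * s * K))
  set ψ : ℝ → ℝ := fun y => exp (s * φh y) - exp (2 * s * K) with hψdef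
  have hψ4 : ContDiff ℝ 4 ψ := ((contDiff_const.mul hφ).exp).sub contDiff_const
  obtain ⟨b2, b3, hψ⟩ := exists_weightJet hψ4
  have φnn : ∀ x ∈ Icc 0 L, 0 ≤ φh x := fun x hx => by
    rcases eq_or_lt_of_le hx.1 with h | h
    · rw [← h, hφ0]
    rcases eq_or_lt_of_le hx.2 with h' | h'
    · rw [h', hφL]
    exact (hφpos x ⟨h, h'⟩).le
  have φle : ∀ x ∈ Icc 0 L, φh x ≤ K := fun x hx => by
    rw [hK]
    exact (le_abs_self _).trans (le_csSup
      (isCompact_Icc.image_of_continuousOn hφ.continuous.abs.continuousOn).bddAbove ⟨x, hx, rfl⟩)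
  have hK0 : 0 < K := (hφpos (L / 2) ⟨by linarith, by linarith⟩).trans_le
    (φle _ ⟨by linarith, by linarith⟩)
  have gle : ∀ x ∈ Icc 0 L, exp (s * φh x) ≤ exp (s * K) := fun x hx =>
    exp_le_exp.2 (mul_le_mul_of_nonneg_left (φle x hx) (by linarith))
  have hc : 0 < exp (2 * s * K) - exp (s * K) :=
    sub_pos.2 (exp_lt_exp.2 (by nlinarith))
  have bound : ∀ {f : ℝ → ℝ}, Continuous f → ∃ B, ∀ x ∈ Icc 0 L, |f x| ≤ B := fun hf =>
    isCompact_Icc.exists_bound_of_continuousOn hf.continuousOn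
  obtain ⟨B0, hB0⟩ := bound hψ.continuous_zero
  obtain ⟨B1, hB1⟩ := bound hψ.continuous_one
  obtain ⟨B2, hB2⟩ := bound hψ.continuous_two
  obtain ⟨B3, hB3⟩ := bound hψ.continuous_three
  obtain ⟨B4, hB4⟩ := bound hψ.c3
  have mem0 : (0:ℝ) ∈ Icc 0 L := ⟨le_rfl, hL.le⟩
  have n0 := (abs_nonneg _).trans (hB0 0 mem0)
  have n1 := (abs_nonneg _).trans (hB1 0 mem0)
  have n2 := (abs_nonneg _).trans (hB2 0 mem0)
  have n3 := (abs_nonneg _).trans (hB3 0 mem0)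
  have n4 := (abs_nonneg _).trans (hB4 0 mem0)
  have nγ := abs_nonneg γ
  obtain ⟨M, hM⟩ : ∃ M, M = 1 + |γ| + T + B0 + B1 + B2 + B3 + B4 := ⟨_, rfl⟩
  have hM1 : 1 ≤ M := by linarith
  have hW : ∀ x ∈ Icc 0 L, ∀ κ, |κ| ≤ T →
      WeightBound M γ κ (ψ x) (deriv ψ x) (deriv (deriv ψ) x) (b2 x) (b3 x) := fun x hx κ hκ =>
    { one_le := hM1
      hγ := by linarith
      hκ := by linarith
      hψ := by linarith [hB0 x hx]
      hb := by linarith [hB1 x hx]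
      hb1 := by linarith [hB2 x hx]
      hb2 := by linarith [hB3 x hx]
      hb3 := by linarith [hB4 x hx] }
  set k₁ := (s ^ 8 * exp (s * K) ^ 7)⁻¹ with hk₁
  have hk₁0 : 0 < k₁ := by positivity
  set c := δ ^ 4 / (1600 * M ^ 6) * k₁ with hcdef
  have hc0 : 0 < c := by positivity
  set A := δ ^ 4 / (1600 * M ^ 6) + 1060 * M ^ 7 * (1600 * M ^ 6) with hA
  have hA0 : 0 < A := by positivity
  have p1 : 0 ≤ T ^ 2 * (1 + 1000 * M ^ 6 / δ ^ 4) := by positivity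
  have p2 : 0 ≤ T ^ 2 * (1 + 61 * M ^ 4 / (48 * δ ^ 5)) := by positivity
  refine ⟨1 + T ^ 2 * (1 + 1000 * M ^ 6 / δ ^ 4) + T ^ 2 * (1 + 61 * M ^ 4 / (48 * δ ^ 5)),
    by positivity, (1 / 2 + A) / c, by positivity, ?_⟩
  intro v hv _ hbd lam hlam
  have hlam1 : 1 ≤ lam := by linarith
  have hlam0 : 0 ≤ lam := by linarith
  obtain ⟨v1, v2, v3, v4, q0, q1, q2, jet⟩ := exists_spaceTimeJet hv
  simp only [jet.deriv_eq, jet.iteratedDeriv_two, jet.iteratedDeriv_three, jet.iteratedDeriv_four]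
    at hbd ⊢
  have eF : ∀ t x, exp (2 * lam * wrho s T K φh t x) *
      (γ * deriv (fun τ => v τ x) t + v4 t x) ^ 2
      = exp (lam / (t * (T - t)) * ψ x) ^ 2 * (γ * q0 t x + v4 t x) ^ 2 := fun t x => by
    rw [(jet.e0 t x).deriv, exp_wrho]
  simp only [eF]
  set J := carlemanDensity lam s T K φh v v1 v2 v3 with hJ
  have cφ := hφ.continuous
  have main := carleman_spaceTime (J := J) (k₁ := k₁) (k₂ := 1) (ω₀ := ω₀) hL hψ hW hT hδ hδ1 hlam1
    (by linarith) (by linarith) hω₀ hωL hgood hb0 hbL hc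
    (fun x hx => by simp only [hψdef]; linarith [gle x hx]) jet
    (fun x hx => by
      rcases hbd with h | h
      · rcases hx with rfl | rfl
        · exact ⟨fun t ht => (h t ht).1, Or.inl fun t ht => (h t ht).2.2.1⟩
        · exact ⟨fun t ht => (h t ht).2.1, Or.inl fun t ht => (h t ht).2.2.2⟩
      · rcases hx with rfl | rfl
        · exact ⟨fun t ht => (h t ht).1, Or.inr fun t ht => (h t ht).2.2.1⟩
        · exact ⟨fun t ht => (h t ht).2.1, Or.inr fun t ht => (h t ht).2.2.2⟩)
    (by
      have m0 : Measurable fun p : ℝ × ℝ => v p.1 p.2 := jet.c0.measurable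
      have m1 : Measurable fun p : ℝ × ℝ => v1 p.1 p.2 := jet.c1.measurable
      have m2 : Measurable fun p : ℝ × ℝ => v2 p.1 p.2 := jet.c2.measurable
      have m3 : Measurable fun p : ℝ × ℝ => v3 p.1 p.2 := jet.c3.measurable
      have m4 : Measurable fun p : ℝ × ℝ => φh p.2 := (cφ.comp continuous_snd).measurable
      simp only [hJ]
      unfold Function.uncurry carlemanDensity wrho wphi
      fun_prop)
    (fun t ht => by
      have cs : ∀ {f : ℝ → ℝ → ℝ}, Continuous (Function.uncurry f) → Continuous (f t) :=
        fun h => h.comp (by fun_prop : Continuous fun x => (t, x))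
      have := cs jet.c0
      have := cs jet.c1
      have := cs jet.c2
      have := cs jet.c3
      simp only [hJ]
      unfold carlemanDensity wrho wphi
      fun_prop)
    (fun t ht x => carlemanDensity_nonneg K φh v v1 v2 v3 x hlam0 ht) hk₁0
    (fun t ht x hx => by
      rw [hk₁, inv_mul_le_iff₀ (by positivity)]
      exact carlemanDensity_le_weightedSq K v v1 v2 v3 hlam0 ht hs1 (φnn x hx) (gle x hx))
    (fun t ht x hx => by
      rw [one_mul]
      exact weightedSq_le_carlemanDensity K v v1 v2 v3 hlam0 ht hs1 (φnn x hx))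
  rw [← hcdef, ← hA, mul_one] at main
  change (∫ t in Ioo 0 T, ∫ x in Ioo 0 L, J t x) ≤
    (1 / 2 + A) / c * (∫ t in Ioo 0 T, ∫ x in ω₀, J t x) + _
  have hIω : 0 ≤ ∫ t in Ioo 0 T, ∫ x in ω₀, J t x :=
    setIntegral_nonneg measurableSet_Ioo fun t ht => integral_nonneg fun x =>
      carlemanDensity_nonneg K φh v v1 v2 v3 x hlam0 ht
  have hIF : 0 ≤ ∫ t in Ioo 0 T, ∫ x in Ioo 0 L,
      exp (lam / (t * (T - t)) * ψ x) ^ 2 * (γ * q0 t x + v4 t x) ^ 2 :=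
    integral_nonneg fun t => integral_nonneg fun x => by positivity
  rw [← mul_add, div_mul_eq_mul_div, le_div_iff₀ hc0, mul_comm]
  refine main.trans ?_
  nlinarith [mul_nonneg hA0.le hIF]
end
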